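/- For every integer k there exists an integer n such that every plane triangulation on at least n vertices has an s-nest of size at least k for some s ∈ {0,1,2}. -/

import Mathlib

open Set Bornology

noncomputable section

namespace CrossingPaper

/-- Points of the plane. -/
abbrev Plane : Type := ℝ × ℝ

/-- A drawing of a (simple) graph `G` in the plane: each vertex is mapped to a point
(injectively), and each edge `e = uv` is mapped to an arc with ends `vmap u`, `vmap v`
whose interior `emap e` avoids all vertex images; any two distinct edges intersect in
finitely many points. -/
structure Drawing {V : Type} (G : SimpleGraph V) where
  vmap : V → Plane
  emap : Sym2 V → Set Plane
  vmap_inj : Function.Injective vmap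
  arc : ∀ e ∈ G.edgeSet, ∀ u v : V, e = s(u, v) →
    ∃ f : ℝ → Plane, ContinuousOn f (Icc 0 1) ∧ InjOn f (Icc 0 1) ∧
      f 0 = vmap u ∧ f 1 = vmap v ∧ emap e = f '' Ioo 0 1
  avoid : ∀ e ∈ G.edgeSet, ∀ v : V, vmap v ∉ emap e
  finite_inter : ∀ e ∈ G.edgeSet, ∀ e' ∈ G.edgeSet, e ≠ e' → (emap e ∩ emap e').Finite

variable {V : Type} {G : SimpleGraph V}

/-- The set of crossings of a drawing: points lying on (the interiors of) two distinct
edges. -/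
def Drawing.crossings (γ : Drawing G) : Set Plane :=
  {p | ∃ e ∈ G.edgeSet, ∃ e' ∈ G.edgeSet, e ≠ e' ∧ p ∈ γ.emap e ∧ p ∈ γ.emap e'}

/-- The crossing number of a graph: the minimum number of crossings over all drawings. -/
def crossingNumber (G : SimpleGraph V) : ℕ :=
  sInf {n | ∃ γ : Drawing G, γ.crossings.Finite ∧ γ.crossings.ncard = n}

/-- `G` is `k`-crossing-critical: `cr(G) ≥ k` and `cr(G - e) < k` for every edge `e`. -/
def CrossingCritical (G : SimpleGraph V) (k : ℕ) : Prop :=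
  k ≤ crossingNumber G ∧
    ∀ e ∈ G.edgeSet, crossingNumber (G.deleteEdges {e}) < k

/-- The image of a subgraph under a drawing. -/
def Drawing.image (γ : Drawing G) (H : G.Subgraph) : Set Plane :=
  γ.vmap '' H.verts ∪ ⋃ e ∈ H.edgeSet, γ.emap e

/-- The image of a whole drawing. -/
def Drawing.totalImage (γ : Drawing G) : Set Plane :=
  range γ.vmap ∪ ⋃ e ∈ G.edgeSet, γ.emap e

/-- The union of all bounded complementary components of a set in the plane: for a
Jordan curve this is the open disk bounded by the curve. -/
def boundedSide (s : Set Plane) : Set Plane :=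
  {p | p ∉ s ∧ IsBounded (connectedComponentIn sᶜ p)}

/-- For a Jordan curve, the closed disk bounded by the curve. -/
def closedRegion (s : Set Plane) : Set Plane :=
  s ∪ boundedSide s

/-- A subgraph is a cycle: connected, finite, and every vertex has exactly two
neighbours. -/
def IsCycleSubgraph (H : G.Subgraph) : Prop :=
  H.Connected ∧ H.verts.Finite ∧ ∀ v ∈ H.verts, (H.neighborSet v).ncard = 2

/-- A subgraph is crossing-free in a drawing if none of its edges is crossed by
another edge of `G`. -/
def Drawing.CrossingFree (γ : Drawing G) (H : G.Subgraph) : Prop :=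
  ∀ e ∈ H.edgeSet, ∀ e' ∈ G.edgeSet, e ≠ e' → γ.emap e ∩ γ.emap e' = ∅

/-- A sequence of cycles `C 0, …, C (t-1)` is a nest in `γ`: the cycles are pairwise
edge-disjoint, each is crossing-free in `γ`, and the image of each cycle is contained
in the closed disk bounded by the image of the previous one. -/
def Drawing.IsNest (γ : Drawing G) {t : ℕ} (C : Fin t → G.Subgraph) : Prop :=
  (∀ i, IsCycleSubgraph (C i)) ∧
  (∀ i j, i ≠ j → Disjoint (C i).edgeSet (C j).edgeSet) ∧
  (∀ i, γ.CrossingFree (C i)) ∧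
  (∀ i : ℕ, ∀ h : i + 1 < t,
    γ.image (C ⟨i + 1, h⟩) ⊆ closedRegion (γ.image (C ⟨i, by omega⟩)))

/-- An `s`-nest: a nest such that any two distinct cycles intersect exactly in a fixed
set `X` of `s` vertices. -/
def Drawing.IsSNest (γ : Drawing G) (s : ℕ) {t : ℕ} (C : Fin t → G.Subgraph) : Prop :=
  γ.IsNest C ∧ ∃ X : Set V, X.Finite ∧ X.ncard = s ∧
    ∀ i j, i ≠ j → (C i).verts ∩ (C j).verts = X

/-- A nest `C 0, …, C (t-1)` in `γ` is clean if every crossing of `γ` lies either in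
the open disk bounded by the image of the last cycle or outside the closed disk
bounded by the image of the first cycle. -/
def Drawing.IsCleanNest (γ : Drawing G) {t : ℕ} (C : Fin t → G.Subgraph) : Prop :=
  ∀ h : 0 < t, ∀ p ∈ γ.crossings,
    p ∈ boundedSide (γ.image (C ⟨t - 1, by omega⟩)) ∨
      p ∉ closedRegion (γ.image (C ⟨0, h⟩))

/-- A drawing is generic: no point lies on three distinct edges, and no two adjacent
edges cross. -/
def Drawing.Generic (γ : Drawing G) : Prop :=
  (∀ p : Plane, ∀ e₁ ∈ G.edgeSet, ∀ e₂ ∈ G.edgeSet, ∀ e₃ ∈ G.edgeSet,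
    p ∈ γ.emap e₁ → p ∈ γ.emap e₂ → p ∈ γ.emap e₃ → e₁ = e₂ ∨ e₁ = e₃ ∨ e₂ = e₃) ∧
  (∀ e ∈ G.edgeSet, ∀ e' ∈ G.edgeSet, e ≠ e' → (∃ v : V, v ∈ e ∧ v ∈ e') →
    γ.emap e ∩ γ.emap e' = ∅)

/-- The faces of a (crossing-free) drawing: the connected components of the complement
of its image. -/
def Drawing.faces (γ : Drawing G) : Set (Set Plane) :=
  {F | ∃ x, x ∉ γ.totalImage ∧ F = connectedComponentIn γ.totalImageᶜ x}

/-- The length of (the boundary of) a face: the number of edges of the graph drawn on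
its frontier. -/
def Drawing.faceLength (γ : Drawing G) (F : Set Plane) : ℕ :=
  {e | e ∈ G.edgeSet ∧ γ.emap e ⊆ frontier F}.ncard

/-- A drawing is a plane triangulation if it has no crossings and every face (including
the outer face) is bounded by a triangle of the graph. -/
def Drawing.IsPlaneTriangulation (γ : Drawing G) : Prop :=
  γ.crossings = ∅ ∧
  ∀ F ∈ γ.faces, ∃ T : G.Subgraph, IsCycleSubgraph T ∧ T.verts.ncard = 3 ∧
    frontier F = γ.image T



/-! ### Part 1: continuous logarithms in the plane -/

/-- The identification of the plane with the complex numbers. -/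
def cz (p : Plane) : ℂ := ⟨p.1, p.2⟩

lemma cz_continuous : Continuous cz := by
  have : cz = fun p : Plane => Complex.equivRealProdCLM.symm p := by
    funext p; rfl
  rw [this]
  exact Complex.equivRealProdCLM.symm.continuous

lemma cz_inj {p q : Plane} (h : cz p = cz q) : p = q := by
  have h1 := congrArg Complex.re h
  have h2 := congrArg Complex.im h
  exact Prod.ext h1 h2

lemma cz_sub_ne {p q : Plane} (h : p ≠ q) : cz p - cz q ≠ 0 :=
  fun h' => h (cz_inj (sub_eq_zero.mp h'))

lemma exp_const_of_preconnected {A : Set Plane} (hA : IsPreconnected A) {h₁ h₂ : Plane → ℂ}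
    (c₁ : ContinuousOn h₁ A) (c₂ : ContinuousOn h₂ A)
    (he : ∀ z ∈ A, Complex.exp (h₁ z) = Complex.exp (h₂ z)) {x y : Plane}
    (hx : x ∈ A) (hy : y ∈ A) : h₁ x - h₂ x = h₁ y - h₂ y := by
  have key : ∀ z ∈ A, ∃ n : ℤ, h₁ z - h₂ z = n * (2 * Real.pi * Complex.I) := by
    intro z hz
    obtain ⟨n, hn⟩ := Complex.exp_eq_exp_iff_exists_int.mp (he z hz)
    exact ⟨n, by rw [hn]; ring⟩
  let g : Plane → ℝ := fun z => (h₁ z - h₂ z).im / (2 * Real.pi)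
  have hpi : (2 * Real.pi) ≠ 0 := by positivity
  have hg : ContinuousOn g A :=
    (Complex.continuous_im.comp_continuousOn (c₁.sub c₂)).div_const _
  have gv : ∀ z ∈ A, ∀ n : ℤ, h₁ z - h₂ z = n * (2 * Real.pi * Complex.I) → g z = n := by
    intro z hz n hn
    simp only [g, hn]
    simp
  have : DiscreteTopology (range (Int.cast : ℤ → ℝ)) :=
    (Int.isClosedEmbedding_coe_real.isEmbedding.toHomeomorph).symm.isEmbedding.discreteTopology
  have hm : MapsTo g A (range (Int.cast : ℤ → ℝ)) := by
    intro z hz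
    obtain ⟨n, hn⟩ := key z hz
    exact ⟨n, (gv z hz n hn).symm⟩
  have e := hA.constant_of_mapsTo ⟨this⟩ hg hm hx hy
  obtain ⟨n, hn⟩ := key x hx
  obtain ⟨m, hm⟩ := key y hy
  rw [gv x hx n hn, gv y hy m hm] at e
  rw [hn, hm, Int.cast_injective e]

/-- Homotopy lifting for `exp`. -/
lemma exists_log_homotopy {A : Set Plane} (H : unitInterval × A → ℂ) (hc : Continuous H)
    (h0 : ∀ x, H x ≠ 0) (h1 : ∀ a, H (0, a) = 1) :
    ∃ h : Plane → ℂ, ContinuousOn h A ∧ ∀ z (hz : z ∈ A), Complex.exp (h z) = H (1, ⟨z, hz⟩) := by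
  classical
  let H' : C(unitInterval × A, {z : ℂ // z ≠ 0}) := ⟨fun x => ⟨H x, h0 x⟩, by fun_prop⟩
  let f : C(A, ℂ) := ⟨fun _ => 0, by fun_prop⟩
  have H0 : ∀ a, H' (0, a) = (fun z : ℂ ↦ (⟨_, z.exp_ne_zero⟩ : {z : ℂ // z ≠ 0})) (f a) := by
    intro a
    apply Subtype.ext
    simp [H', f, h1]
  let Λ := Complex.isCoveringMap_exp.liftHomotopy H' f H0
  have hΛ := Complex.isCoveringMap_exp.liftHomotopy_lifts H' f H0
  refine ⟨fun z => if hz : z ∈ A then Λ (1, ⟨z, hz⟩) else 0, ?_, ?_⟩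
  · rw [continuousOn_iff_continuous_domRestrict]
    have : A.domRestrict (fun z => if hz : z ∈ A then Λ (1, ⟨z, hz⟩) else 0)
        = fun a : A => Λ (1, a) := by
      funext a
      simp [Set.domRestrict]
    rw [this]
    fun_prop
  · intro z hz
    simp only [hz, dif_pos]
    have := congrFun hΛ (1, ⟨z, hz⟩)
    exact congrArg Subtype.val this

lemma exists_log_path {A : Set Plane} {a b : Plane} (hab : JoinedIn Aᶜ a b) :
    ∃ h : Plane → ℂ, ContinuousOn h A ∧
      ∀ z ∈ A, Complex.exp (h z) = (cz z - cz a) / (cz z - cz b) := by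
  obtain ⟨p, hp⟩ := hab
  have hne : ∀ (t : unitInterval) (z : A), cz z.1 - cz (p t) ≠ 0 := by
    intro t z
    apply cz_sub_ne
    intro h
    exact hp t (h ▸ z.2)
  have hcz := cz_continuous
  obtain ⟨h, hh, he⟩ := exists_log_homotopy (A := A)
    (fun x => (cz x.2.1 - cz a) / (cz x.2.1 - cz (p x.1)))
    (by
      apply Continuous.div
      · fun_prop
      · fun_prop
      · intro x; exact hne x.1 x.2)
    (by
      intro x
      have h1 := hne 0 x.2
      rw [p.source] at h1
      exact div_ne_zero h1 (hne x.1 x.2))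
    (by
      intro x
      have h1 := hne 0 x
      rw [p.source] at h1
      simp only [p.source]
      exact div_self h1)
  exact ⟨h, hh, fun z hz => by rw [he z hz]; simp only [p.target]⟩

lemma exists_log_global {F : Plane → ℂ} (hF : Continuous F) (h0 : ∀ z, F z ≠ 0) :
    ∃ h : Plane → ℂ, Continuous h ∧ ∀ z, Complex.exp (h z) = F z := by
  obtain ⟨h, hh, he⟩ := exists_log_homotopy (A := univ)
    (fun x => F ((x.1 : ℝ) • x.2.1) / F 0)
    (by
      apply Continuous.div
      · fun_prop
      · fun_prop
      · intro x; exact h0 _)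
    (by
      intro x
      exact div_ne_zero (h0 _) (h0 _))
    (by
      intro x
      simp [h0])
  refine ⟨fun z => h z + Complex.log (F 0), ?_, ?_⟩
  · rw [← continuousOn_univ]
    exact hh.add continuousOn_const
  · intro z
    rw [Complex.exp_add, he z (mem_univ _), Complex.exp_log (h0 _)]
    simp [h0]

/-- The circle of radius `R` around `a`, as a curve in the plane. -/
def circ (a : Plane) (R : ℝ) (t : ℝ) : Plane := (a.1 + R * Real.cos t, a.2 + R * Real.sin t)

lemma cz_circ (a : Plane) (R t : ℝ) :
    cz (circ a R t) - cz a = R * Complex.exp (t * Complex.I) := by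
  rw [Complex.exp_mul_I]
  apply Complex.ext <;> simp [cz, circ, ← Complex.ofReal_cos, ← Complex.ofReal_sin]

lemma circ_continuous (a : Plane) (R : ℝ) : Continuous (circ a R) := by
  unfold circ; fun_prop

/-- There is no continuous logarithm of `z - a` on a circle around `a`. -/
lemma no_log_circle {a : Plane} {R : ℝ} (hR : 0 < R) {h : Plane → ℂ} (hc : Continuous h)
    (he : ∀ t, Complex.exp (h (circ a R t)) = cz (circ a R t) - cz a) : False := by
  let h₁ : Plane → ℂ := fun p => h (circ a R p.1)
  let h₂ : Plane → ℂ := fun p => Real.log R + p.1 * Complex.I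
  have c1 : Continuous h₁ := hc.comp ((circ_continuous a R).comp continuous_fst)
  have c2 : Continuous h₂ := by fun_prop
  have := exp_const_of_preconnected (A := univ) isPreconnected_univ c1.continuousOn
    c2.continuousOn (by
      intro z _
      simp only [h₁, h₂]
      rw [he, cz_circ, Complex.exp_add, ← Complex.ofReal_exp, Real.exp_log hR])
    (mem_univ ((0 : ℝ), (0 : ℝ))) (mem_univ ((2 * Real.pi : ℝ), (0 : ℝ)))
  have e : circ a R 0 = circ a R (2 * Real.pi) := by simp [circ]
  simp only [h₁, h₂, e] at this
  simp at this

/-- The Eilenberg criterion (separated points have no logarithm). -/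
lemma no_log_of_sep {K U : Set Plane} (hK : IsCompact K) (hb : IsBounded U)
    (hfr : frontier U ⊆ K) {a : Plane} (ha : a ∈ U) {q : Plane → ℂ}
    (hq : ContinuousOn q (closure U)) (hq0 : ∀ z ∈ closure U, q z ≠ 0)
    {h : Plane → ℂ} (hc : ContinuousOn h K)
    (he : ∀ z ∈ K, Complex.exp (h z) = (cz z - cz a) * q z) : False := by
  classical
  obtain ⟨g, hg⟩ := ContinuousMap.exists_restrict_eq hK.isClosed
    (⟨K.domRestrict h, continuousOn_iff_continuous_domRestrict.mp hc⟩ : C(K, ℂ))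
  have hgK : ∀ z ∈ K, g z = h z := by
    intro z hz
    exact congrArg (fun f : C(K, ℂ) => f ⟨z, hz⟩) hg
  let F : Plane → ℂ := fun z => if z ∈ U then Complex.exp (g z) / q z else cz z - cz a
  have hF : Continuous F := by
    apply continuous_if
    · intro z hz
      have hzK := hfr hz
      rw [hgK z hzK, he z hzK]
      have := hq0 z (frontier_subset_closure hz)
      field_simp
    · apply ContinuousOn.div
      · exact (Complex.continuous_exp.comp g.continuous).continuousOn
      · exact hq
      · exact hq0
    · exact (cz_continuous.sub continuous_const).continuousOn
  have hF0 : ∀ z, F z ≠ 0 := by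
    intro z
    simp only [F]
    split_ifs with h1
    · exact div_ne_zero (Complex.exp_ne_zero _) (hq0 z (subset_closure h1))
    · apply cz_sub_ne
      rintro rfl
      exact h1 ha
  obtain ⟨L, hL, hLe⟩ := exists_log_global hF hF0
  obtain ⟨R, hR⟩ := hb.subset_ball a
  have hRpos : 0 < R := by
    have := hR ha
    simpa using this
  apply no_log_circle (a := a) (R := 2 * R) (by positivity) hL
  intro t
  rw [hLe]
  simp only [F]
  rw [if_neg]
  intro hmem
  have hd := hR hmem
  rw [Metric.mem_ball, Prod.dist_eq, max_lt_iff] at hd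
  simp only [circ, Real.dist_eq, add_sub_cancel_left] at hd
  have h1 := sq_lt_sq.mpr (hd.1.trans_le (le_abs_self R))
  have h2 := sq_lt_sq.mpr (hd.2.trans_le (le_abs_self R))
  nlinarith [Real.sin_sq_add_cos_sq t, sq_nonneg R]



/-! ### Part 2: the graph `K_{3,3}` cannot be drawn in the plane -/

/-- The median of three real numbers. -/
def med (a b c : ℝ) : ℝ := max (min a b) (min (max a b) c)

lemma med_cases (a b c : ℝ) : med a b c = a ∨ med a b c = b ∨ med a b c = c := by
  unfold med; grind
lemma med_12 (a c : ℝ) : med a a c = a := by unfold med; grind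
lemma med_13 (a c : ℝ) : med a c a = a := by unfold med; grind
lemma med_23 (a c : ℝ) : med c a a = a := by unfold med; grind

lemma med_cont {A : Set Plane} {z : Plane} {f g h : Plane → ℝ} (hf : ContinuousWithinAt f A z)
    (hg : ContinuousWithinAt g A z) (hh : ContinuousWithinAt h A z) :
    ContinuousWithinAt (fun x => med (f x) (g x) (h x)) A z := by
  unfold med
  exact (hf.min hg).max ((hf.max hg).min hh)

open Filter Topology in
lemma eventually_eq_of_exp {A : Set Plane} {z : Plane} {h₁ h₂ : Plane → ℂ}
    (c₁ : ContinuousWithinAt h₁ A z) (c₂ : ContinuousWithinAt h₂ A z) (hz : h₁ z = h₂ z)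
    (he : ∀ᶠ x in 𝓝[A] z, Complex.exp (h₁ x) = Complex.exp (h₂ x)) :
    ∀ᶠ x in 𝓝[A] z, h₁ x = h₂ x := by
  have hc := c₁.sub c₂
  have h0 : Tendsto (fun x => h₁ x - h₂ x) (𝓝[A] z) (𝓝 0) := by
    have := hc.tendsto
    rwa [Pi.sub_apply, hz, sub_self] at this
  have hlt := h0.eventually (Metric.ball_mem_nhds (0 : ℂ) (one_pos))
  filter_upwards [hlt, he] with x hx hex
  obtain ⟨n, hn⟩ := Complex.exp_eq_exp_iff_exists_int.mp hex
  have hd : h₁ x - h₂ x = n * (2 * Real.pi * Complex.I) := by rw [hn]; ring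
  rw [hd, dist_zero_right] at hx
  have hn0 : n = 0 := by
    by_contra hne
    have h1 : (1 : ℝ) ≤ |(n : ℝ)| := by
      exact_mod_cast Int.one_le_abs hne
    have h2 : ‖(n : ℂ) * (2 * Real.pi * Complex.I)‖ = |(n : ℝ)| * (2 * Real.pi) := by
      simp [abs_of_pos Real.pi_pos]
    rw [h2] at hx
    nlinarith [Real.pi_gt_three]
  rw [hn, hn0]; simp

open Filter Topology in
/-- A topological `K_{3,3}` does not exist in the plane. -/
lemma no_k33 {t b : Fin 3 → Plane} {Y : Fin 3 → Set Plane} (ht : Function.Injective t)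
    (hb : ∀ i, b i ∈ Y i) (hYt : ∀ i j, t j ∉ Y i) (hdis : ∀ i j, i ≠ j → Disjoint (Y i) (Y j))
    (hcpt : ∀ i, IsCompact (Y i ∪ range t))
    (hJ : ∀ i j, JoinedIn (Y i ∪ {t j}) (b i) (t j)) : False := by
  -- separating neighbourhoods
  set T := range t with hT
  have hTY : ∀ i z, z ∈ Y i → z ∉ T := by
    rintro i z hz ⟨j, rfl⟩
    exact hYt i j hz
  have hYd : ∀ i j, i ≠ j → ∀ z, z ∈ Y i → z ∉ Y j := fun i j hij z h1 h2 =>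
    (Set.disjoint_left.mp (hdis i j hij)) h1 h2
  let E₀ : Set Plane := (Y 1 ∪ T) ∪ (Y 2 ∪ T)
  let E₁ : Set Plane := (Y 0 ∪ T) ∪ (Y 2 ∪ T)
  have hE₀ : IsClosed E₀ := ((hcpt 1).union (hcpt 2)).isClosed
  have hE₁ : IsClosed E₁ := ((hcpt 0).union (hcpt 2)).isClosed
  let N₀ : Set Plane := {z | Metric.infDist z (Y 0) < Metric.infDist z E₀}
  let N₁ : Set Plane := {z | Metric.infDist z (Y 1) < Metric.infDist z E₁}
  have oN₀ : IsOpen N₀ := isOpen_lt (Metric.continuous_infDist_pt _) (Metric.continuous_infDist_pt _)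
  have oN₁ : IsOpen N₁ := isOpen_lt (Metric.continuous_infDist_pt _) (Metric.continuous_infDist_pt _)
  have tE₀ : t 0 ∈ E₀ := Or.inl (Or.inr ⟨0, rfl⟩)
  have tE₁ : t 0 ∈ E₁ := Or.inl (Or.inr ⟨0, rfl⟩)
  have YN₀ : Y 0 ⊆ N₀ := by
    intro z hz
    have h1 : Metric.infDist z (Y 0) = 0 := Metric.infDist_zero_of_mem hz
    have h2 : 0 < Metric.infDist z E₀ := by
      rw [← hE₀.notMem_iff_infDist_pos ⟨_, tE₀⟩]
      rintro ((h | h) | (h | h))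
      · exact hYd 0 1 (by decide) z hz h
      · exact hTY 0 z hz h
      · exact hYd 0 2 (by decide) z hz h
      · exact hTY 0 z hz h
    simp only [N₀, mem_ofPred_eq, h1, h2]
  have YN₁ : Y 1 ⊆ N₁ := by
    intro z hz
    have h1 : Metric.infDist z (Y 1) = 0 := Metric.infDist_zero_of_mem hz
    have h2 : 0 < Metric.infDist z E₁ := by
      rw [← hE₁.notMem_iff_infDist_pos ⟨_, tE₁⟩]
      rintro ((h | h) | (h | h))
      · exact hYd 1 0 (by decide) z hz h
      · exact hTY 1 z hz h
      · exact hYd 1 2 (by decide) z hz h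
      · exact hTY 1 z hz h
    simp only [N₁, mem_ofPred_eq, h1, h2]
  have Ndis : Disjoint N₀ N₁ := by
    rw [Set.disjoint_left]
    intro z h0 h1
    have a1 : Metric.infDist z E₀ ≤ Metric.infDist z (Y 1) :=
      Metric.infDist_le_infDist_of_subset (fun x hx => Or.inl (Or.inl hx)) ⟨_, hb 1⟩
    have a2 : Metric.infDist z E₁ ≤ Metric.infDist z (Y 0) :=
      Metric.infDist_le_infDist_of_subset (fun x hx => Or.inl (Or.inl hx)) ⟨_, hb 0⟩
    simp only [N₀, N₁, mem_ofPred_eq] at h0 h1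
    linarith
  obtain ⟨R, hR⟩ := (hcpt 0).isBounded.subset_ball 0
  let U : Set Plane := N₀ ∩ Metric.ball 0 R
  have oU : IsOpen U := oN₀.inter Metric.isOpen_ball
  have bU : IsBounded U := Metric.isBounded_ball.subset inter_subset_right
  have YU : Y 0 ⊆ U := fun z hz => ⟨YN₀ hz, hR (Or.inl hz)⟩
  have clU : ∀ z ∈ Y 1, z ∉ closure U := by
    intro z hz hcl
    obtain ⟨x, hx1, hx2⟩ := mem_closure_iff.mp hcl N₁ oN₁ (YN₁ hz)
    exact Set.disjoint_left.mp Ndis hx2.1 hx1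
  let K : Set Plane := frontier U ∪ (Y 2 ∪ T)
  have hK : IsCompact K := by
    refine IsCompact.union ?_ (hcpt 2)
    exact Metric.isCompact_of_isClosed_isBounded isClosed_frontier
      (bU.closure.subset frontier_subset_closure)
  have K0 : ∀ z ∈ Y 0, z ∉ K := by
    rintro z hz (h | (h | h))
    · rw [oU.frontier_eq] at h
      exact h.2 (YU hz)
    · exact hYd 0 2 (by decide) z hz h
    · exact hTY 0 z hz h
  have K1 : ∀ z ∈ Y 1, z ∉ K := by
    rintro z hz (h | (h | h))
    · exact clU z hz (frontier_subset_closure h)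
    · exact hYd 1 2 (by decide) z hz h
    · exact hTY 1 z hz h
  let f : Plane → ℂ := fun z => (cz z - cz (b 0)) / (cz z - cz (b 1))
  have f0 : ∀ z ∈ K, f z ≠ 0 := by
    intro z hz
    refine div_ne_zero (cz_sub_ne ?_) (cz_sub_ne ?_)
    · rintro rfl; exact K0 _ (hb 0) hz
    · rintro rfl; exact K1 _ (hb 1) hz
  have fc : ContinuousOn f K := by
    apply ContinuousOn.div
    · exact (cz_continuous.sub continuous_const).continuousOn
    · exact (cz_continuous.sub continuous_const).continuousOn
    · intro z hz
      apply cz_sub_ne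
      rintro rfl; exact K1 _ (hb 1) hz
  have b2K : ∀ j, b 2 ∈ K \ {t j} := fun j => ⟨Or.inr (Or.inl (hb 2)), by
    rintro h
    exact hYt 2 j (h ▸ hb 2)⟩
  -- the three logarithms
  have hex : ∀ j, ∃ h : Plane → ℂ, ContinuousOn h (K \ {t j}) ∧
      (∀ z ∈ K \ {t j}, Complex.exp (h z) = f z) ∧ h (b 2) = Complex.log (f (b 2)) := by
    intro j
    have hj : JoinedIn (K \ {t j})ᶜ (b 0) (b 1) := by
      have j0 : JoinedIn (K \ {t j})ᶜ (b 0) (t j) := by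
        refine (hJ 0 j).mono ?_
        rintro z (hz | hz) hzK
        · exact K0 z hz hzK.1
        · exact hzK.2 hz
      have j1 : JoinedIn (K \ {t j})ᶜ (b 1) (t j) := by
        refine (hJ 1 j).mono ?_
        rintro z (hz | hz) hzK
        · exact K1 z hz hzK.1
        · exact hzK.2 hz
      exact j0.trans j1.symm
    obtain ⟨h, hc, he⟩ := exists_log_path hj
    refine ⟨fun z => h z - h (b 2) + Complex.log (f (b 2)), ?_, ?_, by ring⟩
    · exact (hc.sub continuousOn_const).add continuousOn_const
    · intro z hz
      have e2 := he _ (b2K j)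
      rw [Complex.exp_add, Complex.exp_sub, Complex.exp_log (f0 _ (b2K j).1), he z hz, e2]
      have := f0 _ (b2K j).1
      change f z / f (b 2) * f (b 2) = f z
      field_simp
  choose h hc he hb2 using hex
  -- continuity of the logarithms at points of K
  have hcw : ∀ j, ∀ z ∈ K, z ≠ t j → ContinuousWithinAt (h j) K z := by
    intro j z hz hne
    have := hc j z ⟨hz, hne⟩
    refine this.mono_of_mem_nhdsWithin ?_
    exact inter_mem self_mem_nhdsWithin (mem_nhdsWithin_of_mem_nhds (isOpen_compl_singleton.mem_nhds hne))
  have tK : ∀ l, t l ∈ K := fun l => Or.inr (Or.inr ⟨l, rfl⟩)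
  have htl : ∀ i j l, i ≠ l → j ≠ l → h i (t l) = h j (t l) := by
    intro i j l hil hjl
    obtain ⟨p, hp⟩ := hJ 2 l
    have hpre : IsPreconnected (range p) := isPreconnected_range p.continuous
    have hsub : ∀ m, m ≠ l → range p ⊆ K \ {t m} := by
      rintro m hm _ ⟨s, rfl⟩
      rcases hp s with hs | hs
      · exact ⟨Or.inr (Or.inl hs), fun hh => hYt 2 m (by rw [← mem_singleton_iff.mp hh]; exact hs)⟩
      · rw [mem_singleton_iff.mp hs]
        exact ⟨tK l, fun hh => hm (ht hh).symm⟩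
    have := exp_const_of_preconnected hpre ((hc i).mono (hsub i hil)) ((hc j).mono (hsub j hjl))
      (fun z hz => by rw [he i z (hsub i hil hz), he j z (hsub j hjl hz)])
      (x := t l) (y := b 2) ⟨1, p.target⟩ ⟨0, p.source⟩
    rw [hb2, hb2, sub_self] at this
    exact sub_eq_zero.mp this
  have hev : ∀ i j l, i ≠ l → j ≠ l → ∀ᶠ x in 𝓝[K] (t l), h i x = h j x := by
    intro i j l hil hjl
    have hne : ∀ m, m ≠ l → t l ≠ t m := fun m hm hh => hm (ht hh).symm
    refine eventually_eq_of_exp (hcw i _ (tK l) (hne i hil)) (hcw j _ (tK l) (hne j hjl))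
      (htl i j l hil hjl) ?_
    have e1 : ∀ m, m ≠ l → ∀ᶠ x in 𝓝[K] (t l), x ≠ t m := fun m hm =>
      mem_nhdsWithin_of_mem_nhds (isOpen_compl_singleton.mem_nhds (hne m hm))
    filter_upwards [e1 i hil, e1 j hjl, self_mem_nhdsWithin] with x h1 h2 h3
    rw [he i x ⟨h3, h1⟩, he j x ⟨h3, h2⟩]
  let M : Plane → ℂ := fun z => ⟨Real.log ‖f z‖, med (h 0 z).im (h 1 z).im (h 2 z).im⟩
  have hMform : ∀ j, ∀ z ∈ K, z ≠ t j → (⟨Real.log ‖f z‖, (h j z).im⟩ : ℂ) = h j z := by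
    intro j z hz hne
    apply Complex.ext
    · simp only
      rw [← he j z ⟨hz, hne⟩, Complex.norm_exp, Real.log_exp]
    · rfl
  have hMl : ∀ l, ∃ i, i ≠ l ∧ ∀ᶠ x in 𝓝[K] (t l), M x = h i x := by
    intro l
    have e1 : ∀ m, m ≠ l → ∀ᶠ x in 𝓝[K] (t l), x ≠ t m := fun m hm =>
      mem_nhdsWithin_of_mem_nhds (isOpen_compl_singleton.mem_nhds (fun hh => hm (ht hh).symm))
    fin_cases l
    · refine ⟨1, by decide, ?_⟩
      filter_upwards [e1 1 (by decide), hev 1 2 0 (by decide) (by decide), self_mem_nhdsWithin]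
        with x h1 h2 h3
      rw [← hMform 1 x h3 h1]
      simp only [M, ← h2, med_23]
    · refine ⟨0, by decide, ?_⟩
      filter_upwards [e1 0 (by decide), hev 0 2 1 (by decide) (by decide), self_mem_nhdsWithin]
        with x h1 h2 h3
      rw [← hMform 0 x h3 h1]
      simp only [M, ← h2, med_13]
    · refine ⟨0, by decide, ?_⟩
      filter_upwards [e1 0 (by decide), hev 0 1 2 (by decide) (by decide), self_mem_nhdsWithin]
        with x h1 h2 h3
      rw [← hMform 0 x h3 h1]
      simp only [M, ← h2, med_12]
  have hMe : ∀ z ∈ K, Complex.exp (M z) = f z := by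
    intro z hz
    by_cases hzT : z ∈ T
    · obtain ⟨l, rfl⟩ := hzT
      obtain ⟨i, hil, hi⟩ := hMl l
      rw [hi.self_of_nhdsWithin hz, he i _ ⟨hz, fun hh => hil (ht hh).symm⟩]
    · have hne : ∀ j, z ≠ t j := fun j hh => hzT ⟨j, hh.symm⟩
      rcases med_cases (h 0 z).im (h 1 z).im (h 2 z).im with hm | hm | hm
      · simp only [M, hm]; rw [hMform 0 z hz (hne 0), he 0 z ⟨hz, hne 0⟩]
      · simp only [M, hm]; rw [hMform 1 z hz (hne 1), he 1 z ⟨hz, hne 1⟩]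
      · simp only [M, hm]; rw [hMform 2 z hz (hne 2), he 2 z ⟨hz, hne 2⟩]
  have hMc : ContinuousOn M K := by
    intro z hz
    by_cases hzT : z ∈ T
    · obtain ⟨l, rfl⟩ := hzT
      obtain ⟨i, hil, hi⟩ := hMl l
      exact (hcw i _ hz (fun hh => hil (ht hh).symm)).congr_of_eventuallyEq hi
        (hi.self_of_nhdsWithin hz)
    · have hne : ∀ j, z ≠ t j := fun j hh => hzT ⟨j, hh.symm⟩
      have c1 : ∀ j, ContinuousWithinAt (fun x => (h j x).im) K z := fun j =>
        Complex.continuous_im.continuousAt.comp_continuousWithinAt (hcw j z hz (hne j))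
      have c2 : ContinuousWithinAt (fun x => Real.log ‖f x‖) K z :=
        ((fc z hz).norm).log (norm_ne_zero_iff.mpr (f0 z hz))
      have c3 := med_cont (c1 0) (c1 1) (c1 2)
      have : M = fun x => ((Real.log ‖f x‖ : ℝ) : ℂ)
          + ((med (h 0 x).im (h 1 x).im (h 2 x).im : ℝ) : ℂ) * Complex.I := by
        funext x
        exact (Complex.mk_eq_add_mul_I _ _)
      rw [this]
      exact (Complex.continuous_ofReal.continuousAt.comp_continuousWithinAt c2).add
        ((Complex.continuous_ofReal.continuousAt.comp_continuousWithinAt c3).mul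
          continuousWithinAt_const)
  refine no_log_of_sep hK bU (fun z hz => Or.inl hz) (YU (hb 0))
    (q := fun z => (cz z - cz (b 1))⁻¹) ?_ ?_ hMc (fun z hz => by rw [hMe z hz]; rfl)
  · apply ContinuousOn.inv₀
    · exact (cz_continuous.sub continuous_const).continuousOn
    · intro z hz
      apply cz_sub_ne
      rintro rfl; exact clU _ (hb 1) hz
  · intro z hz
    apply inv_ne_zero
    apply cz_sub_ne
    rintro rfl; exact clU _ (hb 1) hz



/-! ### Part 3: stars of vertices and separation -/

/-- The union of a set of vertices and edges in a drawing. -/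
def imSE (γ : Drawing G) (S : Set V) (E : Set (Sym2 V)) : Set Plane :=
  γ.vmap '' S ∪ ⋃ e ∈ E, γ.emap e

/-- The closed arc representing an edge. -/
def carc (γ : Drawing G) (e : Sym2 V) : Set Plane := γ.emap e ∪ γ.vmap '' {v | v ∈ e}

lemma image_eq_imSE (γ : Drawing G) (H : G.Subgraph) : γ.image H = imSE γ H.verts H.edgeSet := rfl

lemma totalImage_eq_imSE (γ : Drawing G) : γ.totalImage = imSE γ univ G.edgeSet := by
  simp [Drawing.totalImage, imSE]

lemma carc_param (γ : Drawing G) {u v : V} (h : G.Adj u v) :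
    ∃ f : ℝ → Plane, ContinuousOn f (Icc 0 1) ∧ InjOn f (Icc 0 1) ∧
      f 0 = γ.vmap u ∧ f 1 = γ.vmap v ∧ γ.emap s(u, v) = f '' Ioo 0 1 ∧
      carc γ s(u, v) = f '' Icc 0 1 := by
  obtain ⟨f, h1, h2, h3, h4, h5⟩ := γ.arc s(u, v) h u v rfl
  refine ⟨f, h1, h2, h3, h4, h5, ?_⟩
  have : Icc (0 : ℝ) 1 = Ioo 0 1 ∪ {0, 1} := by
    rw [Ioo_union_both (by norm_num)]
  rw [this, image_union, ← h5, image_pair, h3, h4, carc]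
  congr 1
  ext z; simp only [mem_image, mem_ofPred_eq, Sym2.mem_iff, mem_insert_iff, mem_singleton_iff]
  constructor
  · rintro ⟨x, rfl | rfl, rfl⟩ <;> simp
  · rintro (rfl | rfl)
    · exact ⟨u, Or.inl rfl, rfl⟩
    · exact ⟨v, Or.inr rfl, rfl⟩

lemma carc_compact (γ : Drawing G) {e : Sym2 V} (h : e ∈ G.edgeSet) : IsCompact (carc γ e) := by
  induction e with | _ u v =>
  obtain ⟨f, h1, -, -, -, -, h5⟩ := carc_param γ h
  rw [h5]; exact isCompact_Icc.image_of_continuousOn h1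

lemma carc_preconnected (γ : Drawing G) {e : Sym2 V} (h : e ∈ G.edgeSet) :
    IsPreconnected (carc γ e) := by
  induction e with | _ u v =>
  obtain ⟨f, h1, -, -, -, -, h5⟩ := carc_param γ h
  rw [h5]; exact isPreconnected_Icc.image f h1

lemma vmap_mem_carc (γ : Drawing G) {e : Sym2 V} {v : V} (h : v ∈ e) : γ.vmap v ∈ carc γ e :=
  Or.inr ⟨v, h, rfl⟩

/-- A subpath of the closed arc of an edge. -/
lemma joinedIn_image {f : ℝ → Plane} {s : Set ℝ} (hs : Convex ℝ s) (hf : ContinuousOn f s)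
    {a b : ℝ} (ha : a ∈ s) (hb : b ∈ s) : JoinedIn (f '' s) (f a) (f b) := by
  have : IsPathConnected (f '' s) := (hs.isPathConnected ⟨a, ha⟩).image' hf
  exact this.joinedIn _ ⟨a, ha, rfl⟩ _ ⟨b, hb, rfl⟩

lemma carc_joined (γ : Drawing G) {u v : V} (h : G.Adj u v) :
    JoinedIn (carc γ s(u, v)) (γ.vmap u) (γ.vmap v) := by
  obtain ⟨f, h1, -, h3, h4, -, h5⟩ := carc_param γ h
  rw [h5, ← h3, ← h4]
  exact joinedIn_image (convex_Icc 0 1) h1 (by simp) (by simp)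

lemma emap_joined (γ : Drawing G) {u v : V} (h : G.Adj u v) {p : Plane} (hp : p ∈ γ.emap s(u, v)) :
    JoinedIn (γ.emap s(u, v) ∪ {γ.vmap u}) p (γ.vmap u) := by
  obtain ⟨f, h1, -, h3, h4, h6, h5⟩ := carc_param γ h
  rw [h6] at hp ⊢
  obtain ⟨t, ht, rfl⟩ := hp
  have : f '' Ioo 0 1 ∪ {γ.vmap u} = f '' Ico 0 1 := by
    rw [← h3, ← image_singleton, ← image_union, Ioo_union_left (by norm_num)]
  rw [this, ← h3]
  exact joinedIn_image (convex_Ico 0 1) (h1.mono Ico_subset_Icc_self) ⟨ht.1.le, ht.2⟩ (by simp)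

lemma imSE_eq (γ : Drawing G) {S : Set V} {E : Set (Sym2 V)}
    (hS : ∀ e ∈ E, ∀ v ∈ e, v ∈ S) : imSE γ S E = γ.vmap '' S ∪ ⋃ e ∈ E, carc γ e := by
  apply Subset.antisymm
  · apply union_subset_union_right
    exact iUnion₂_mono fun e _ => subset_union_left
  · apply union_subset subset_union_left
    apply iUnion₂_subset
    intro e he
    apply union_subset
    · exact subset_union_of_subset_right (subset_biUnion_of_mem he) _
    · rintro _ ⟨v, hv, rfl⟩
      exact Or.inl ⟨v, hS e he v hv, rfl⟩

lemma imSE_compact [Finite V] (γ : Drawing G) {S : Set V} {E : Set (Sym2 V)} (hE : E ⊆ G.edgeSet)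
    (hS : ∀ e ∈ E, ∀ v ∈ e, v ∈ S) : IsCompact (imSE γ S E) := by
  rw [imSE_eq γ hS]
  refine IsCompact.union ((Set.toFinite S).image _).isCompact ?_
  exact (Set.toFinite E).isCompact_biUnion fun e he => carc_compact γ (hE he)

lemma image_compact [Finite V] (γ : Drawing G) (H : G.Subgraph) : IsCompact (γ.image H) := by
  rw [image_eq_imSE]
  exact imSE_compact γ H.edgeSet_subset (fun e he v hv => H.mem_verts_of_mem_edge he hv)

lemma totalImage_compact [Finite V] (γ : Drawing G) : IsCompact γ.totalImage := by
  rw [totalImage_eq_imSE]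
  exact imSE_compact γ subset_rfl (fun e he v hv => mem_univ _)

lemma image_subset_totalImage (γ : Drawing G) (H : G.Subgraph) : γ.image H ⊆ γ.totalImage := by
  rw [image_eq_imSE, totalImage_eq_imSE]
  exact union_subset_union (image_mono (subset_univ _)) (biUnion_subset_biUnion_left H.edgeSet_subset)

lemma vmap_mem_imSE (γ : Drawing G) {S : Set V} {E : Set (Sym2 V)} (hE : E ⊆ G.edgeSet) {v : V} :
    γ.vmap v ∈ imSE γ S E ↔ v ∈ S := by
  constructor
  · rintro (⟨w, hw, h⟩ | h)
    · rwa [← γ.vmap_inj h]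
    · obtain ⟨e, he, hv⟩ := mem_iUnion₂.mp h
      exact absurd hv (γ.avoid e (hE he) v)
  · exact fun h => Or.inl ⟨v, h, rfl⟩

lemma emap_inj_of_planar {γ : Drawing G} (h0 : γ.crossings = ∅) {e e' : Sym2 V} (he : e ∈ G.edgeSet)
    (he' : e' ∈ G.edgeSet) {p : Plane} (h : p ∈ γ.emap e) (h' : p ∈ γ.emap e') : e = e' := by
  by_contra hne
  have : p ∈ γ.crossings := ⟨e, he, e', he', hne, h, h'⟩
  rw [h0] at this; exact this

lemma emap_mem_imSE {γ : Drawing G} (h0 : γ.crossings = ∅) {S : Set V} {E : Set (Sym2 V)}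
    (hE : E ⊆ G.edgeSet) {e : Sym2 V} (he : e ∈ G.edgeSet) {p : Plane} (hp : p ∈ γ.emap e)
    (h : p ∈ imSE γ S E) : e ∈ E := by
  rcases h with ⟨w, hw, rfl⟩ | h
  · exact absurd hp (γ.avoid e he w)
  · obtain ⟨e', he', hv⟩ := mem_iUnion₂.mp h
    rwa [emap_inj_of_planar h0 he (hE he') hp hv]

/-- The face containing a point. -/
def faceAt (γ : Drawing G) (p : Plane) : Set Plane := connectedComponentIn γ.totalImageᶜ p

/-- `p` belongs to the open star of the vertex `v`. -/
def Near (γ : Drawing G) (p : Plane) (v : V) : Prop :=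
  p = γ.vmap v ∨ (∃ e ∈ G.edgeSet, v ∈ e ∧ p ∈ γ.emap e) ∨
    (p ∉ γ.totalImage ∧ γ.vmap v ∈ frontier (faceAt γ p))

lemma vmap_mem_total (γ : Drawing G) (v : V) : γ.vmap v ∈ γ.totalImage := Or.inl ⟨v, rfl⟩

lemma emap_mem_total (γ : Drawing G) {e : Sym2 V} (he : e ∈ G.edgeSet) {p : Plane}
    (hp : p ∈ γ.emap e) : p ∈ γ.totalImage := Or.inr (mem_iUnion₂.mpr ⟨e, he, hp⟩)

lemma face_triangle {γ : Drawing G} (hγ : γ.IsPlaneTriangulation) {p : Plane}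
    (hp : p ∉ γ.totalImage) : ∃ T : G.Subgraph, frontier (faceAt γ p) = γ.image T ∧
      T.verts.Nonempty ∧ ∀ v ∈ T.verts, ∀ w ∈ T.verts, v ≠ w → G.Adj v w := by
  obtain ⟨T, ⟨h1, h2, h3⟩, h4, h5⟩ := hγ.2 _ ⟨p, hp, rfl⟩
  refine ⟨T, h5, ?_, ?_⟩
  · by_contra h
    rw [not_nonempty_iff_eq_empty.mp h] at h4
    simp at h4
  · intro v hv w hw hne
    have hsub : T.neighborSet v ⊆ T.verts \ {v} := by
      intro x hx
      exact ⟨T.edge_vert (T.adj_symm hx), fun h => (T.adj_sub hx).ne h.symm⟩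
    have hc : (T.verts \ {v}).ncard = 2 := by
      rw [ncard_sdiff_singleton_of_mem hv, h4]
    have heq := eq_of_subset_of_ncard_le hsub (by rw [hc, h3 v hv]) (h2.subset sdiff_subset)
    have : w ∈ T.neighborSet v := by rw [heq]; exact ⟨hw, hne.symm⟩
    exact T.adj_sub this

lemma near_adj {γ : Drawing G} (hγ : γ.IsPlaneTriangulation) {p : Plane} {v w : V} (hne : v ≠ w)
    (hv : Near γ p v) (hw : Near γ p w) : G.Adj v w := by
  rcases hv with rfl | ⟨e, he, hve, hpe⟩ | ⟨hp, hvf⟩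
  · rcases hw with h | ⟨e, he, hve, hpe⟩ | ⟨hp, hvf⟩
    · exact absurd (γ.vmap_inj h) hne
    · exact absurd hpe (γ.avoid e he v)
    · exact absurd (vmap_mem_total γ v) hp
  · rcases hw with rfl | ⟨e', he', hve', hpe'⟩ | ⟨hp, hvf⟩
    · exact absurd hpe (γ.avoid e he w)
    · obtain rfl := emap_inj_of_planar hγ.1 he he' hpe hpe'
      rw [(Sym2.mem_and_mem_iff hne).mp ⟨hve, hve'⟩] at he
      exact he
    · exact absurd (emap_mem_total γ he hpe) hp
  · rcases hw with rfl | ⟨e', he', hve', hpe'⟩ | ⟨hp, hwf⟩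
    · exact absurd (vmap_mem_total γ w) hp
    · exact absurd (emap_mem_total γ he' hpe') hp
    · obtain ⟨T, hT, -, hadj⟩ := face_triangle hγ hp
      rw [hT, image_eq_imSE, vmap_mem_imSE γ T.edgeSet_subset] at hvf hwf
      exact hadj v hvf w hwf hne

lemma near_exists {γ : Drawing G} (hγ : γ.IsPlaneTriangulation) (p : Plane) : ∃ v, Near γ p v := by
  by_cases hp : p ∈ γ.totalImage
  · rcases hp with ⟨v, rfl⟩ | h
    · exact ⟨v, Or.inl rfl⟩
    · obtain ⟨e, he, hpe⟩ := mem_iUnion₂.mp h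
      induction e with | _ u v =>
      exact ⟨u, Or.inr (Or.inl ⟨_, he, Sym2.mem_mk_left _ _, hpe⟩)⟩
  · obtain ⟨T, hT, ⟨v, hv⟩, -⟩ := face_triangle hγ hp
    refine ⟨v, Or.inr (Or.inr ⟨hp, ?_⟩)⟩
    rw [hT]; exact Or.inl ⟨v, hv, rfl⟩

lemma faceAt_open [Finite V] (γ : Drawing G) (p : Plane) : IsOpen (faceAt γ p) :=
  (totalImage_compact γ).isClosed.isOpen_compl.connectedComponentIn

lemma faceAt_eq (γ : Drawing G) {p q : Plane} (h : q ∈ faceAt γ p) : faceAt γ q = faceAt γ p :=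
  (connectedComponentIn_eq h).symm

lemma near_face (γ : Drawing G) {p q : Plane} (hp : p ∉ γ.totalImage) (h : q ∈ faceAt γ p) (v : V) :
    Near γ q v ↔ Near γ p v := by
  have hq : q ∉ γ.totalImage := connectedComponentIn_subset _ _ h
  have aux : ∀ z, z ∉ γ.totalImage → (Near γ z v ↔ γ.vmap v ∈ frontier (faceAt γ z)) := by
    intro z hz
    constructor
    · rintro (rfl | ⟨e, he, hve, hpe⟩ | ⟨hp, hvf⟩)
      · exact absurd (vmap_mem_total γ v) hz
      · exact absurd (emap_mem_total γ he hpe) hz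
      · exact hvf
    · exact fun h => Or.inr (Or.inr ⟨hz, h⟩)
  rw [aux q hq, aux p hp, faceAt_eq γ h]

lemma mem_faceAt (γ : Drawing G) {p : Plane} (hp : p ∉ γ.totalImage) : p ∈ faceAt γ p :=
  mem_connectedComponentIn hp

/-- Open stars are open. -/
lemma near_open [Finite V] {γ : Drawing G} (hγ : γ.IsPlaneTriangulation) (v : V) :
    IsOpen {p | Near γ p v} := by
  rw [isOpen_iff_mem_nhds]
  intro p hp
  by_cases hpt : p ∈ γ.totalImage
  · let E : Set (Sym2 V) := {e | e ∈ G.edgeSet ∧ v ∉ e}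
    let K := imSE γ {v}ᶜ E
    have hKc : IsCompact K := imSE_compact γ (fun e he => he.1)
      (fun e he w hw => by rintro rfl; exact he.2 hw)
    have key : ∀ z ∈ γ.totalImage, z ∉ K → (z = γ.vmap v ∨ ∃ e ∈ G.edgeSet, v ∈ e ∧ z ∈ γ.emap e) := by
      rintro z (⟨w, rfl⟩ | h) hz
      · by_cases hwv : w = v
        · rw [hwv]; exact Or.inl rfl
        · exact absurd (Or.inl ⟨w, hwv, rfl⟩) hz
      · obtain ⟨e, he, hze⟩ := mem_iUnion₂.mp h
        by_cases hve : v ∈ e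
        · exact Or.inr ⟨e, he, hve, hze⟩
        · exact absurd (Or.inr (mem_iUnion₂.mpr ⟨e, ⟨he, hve⟩, hze⟩)) hz
    have hpK : p ∉ K := by
      rintro (⟨w, hw, rfl⟩ | h)
      · rcases hp with h | ⟨e, he, hve, hpe⟩ | ⟨hp, hvf⟩
        · exact hw (γ.vmap_inj h)
        · exact γ.avoid e he w hpe
        · exact hp hpt
      · obtain ⟨e, he, hze⟩ := mem_iUnion₂.mp h
        rcases hp with rfl | ⟨e', he', hve, hpe⟩ | ⟨hp, hvf⟩
        · exact γ.avoid e he.1 v hze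
        · obtain rfl := emap_inj_of_planar hγ.1 he.1 he' hze hpe
          exact he.2 hve
        · exact hp hpt
    obtain ⟨r, hr, hball⟩ := Metric.isOpen_iff.mp hKc.isClosed.isOpen_compl p hpK
    refine Filter.mem_of_superset (Metric.ball_mem_nhds p hr) ?_
    intro q hq
    by_cases hqt : q ∈ γ.totalImage
    · rcases key q hqt (hball hq) with h | h
      · exact Or.inl h
      · exact Or.inr (Or.inl h)
    · refine Or.inr (Or.inr ⟨hqt, ?_⟩)
      have hseg : segment ℝ q p ⊆ Metric.ball p r :=
        (convex_ball p r).segment_subset hq (Metric.mem_ball_self hr)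
      have hpre : IsPreconnected (segment ℝ q p) := (convex_segment q p).isPreconnected
      have hne : (segment ℝ q p ∩ frontier (faceAt γ q)).Nonempty := by
        by_contra hemp
        rw [not_nonempty_iff_eq_empty] at hemp
        obtain ⟨z, hz, hz1, hz2⟩ := hpre (faceAt γ q) (closure (faceAt γ q))ᶜ (faceAt_open γ q)
          isClosed_closure.isOpen_compl (fun z hz => by
            by_cases hzF : z ∈ faceAt γ q
            · exact Or.inl hzF
            · refine Or.inr fun hcl => ?_
              have : z ∈ segment ℝ q p ∩ frontier (faceAt γ q) :=
                ⟨hz, by rw [(faceAt_open γ q).frontier_eq]; exact ⟨hcl, hzF⟩⟩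
              rw [hemp] at this; exact this)
          ⟨q, left_mem_segment ℝ q p, mem_faceAt γ hqt⟩
          ⟨p, right_mem_segment ℝ q p, fun hcl => by
            have hpF : p ∉ faceAt γ q := fun h => connectedComponentIn_subset _ _ h hpt
            have : p ∈ segment ℝ q p ∩ frontier (faceAt γ q) :=
                ⟨right_mem_segment ℝ q p, by rw [(faceAt_open γ q).frontier_eq]; exact ⟨hcl, hpF⟩⟩
            rw [hemp] at this; exact this⟩
        exact hz2 (subset_closure hz1)
      obtain ⟨z, hz1, hz2⟩ := hne
      obtain ⟨T, hT, -, -⟩ := face_triangle hγ hqt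
      rw [hT] at hz2 ⊢
      have hzt := image_subset_totalImage γ T hz2
      rcases key z hzt (hball (hseg hz1)) with rfl | ⟨e, he, hve, hze⟩
      · exact hz2
      · have heT : e ∈ T.edgeSet := emap_mem_imSE hγ.1 T.edgeSet_subset he hze hz2
        exact Or.inl ⟨v, T.mem_verts_of_mem_edge heT hve, rfl⟩
  · refine Filter.mem_of_superset ((faceAt_open γ p).mem_nhds (mem_faceAt γ hpt)) ?_
    intro q hq
    exact (near_face γ hpt hq v).mpr hp

/-- The set of edges of `G` with both ends in `S`. -/
def edgesIn (G : SimpleGraph V) (S : Set V) : Set (Sym2 V) := {e | e ∈ G.edgeSet ∧ ∀ v ∈ e, v ∈ S}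

/-- `p` can see a vertex set cut: the union of stars of `A` is bounded by the drawing of `G[S]`. -/
lemma no_log_cut [Finite V] {γ : Drawing G} (hγ : γ.IsPlaneTriangulation) {A S : Set V} {x : V}
    (hx : x ∈ A) (hN : ∀ a ∈ A, ∀ b, G.Adj a b → b ∈ A ∨ b ∈ S)
    {F : Set Plane} (hF : ∃ p, p ∉ γ.totalImage ∧ F = faceAt γ p)
    {R : ℝ} (hFR : ∀ z : Plane, R < ‖z‖ → z ∈ F)
    (hAF : ∀ a ∈ A, γ.vmap a ∉ frontier F)
    {h : Plane → ℂ} (hc : ContinuousOn h (imSE γ S (edgesIn G S)))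
    (he : ∀ z ∈ imSE γ S (edgesIn G S), Complex.exp (h z) = cz z - cz (γ.vmap x)) : False := by
  let U : Set Plane := ⋃ a ∈ A, {p | Near γ p a}
  have hU : IsOpen U := isOpen_biUnion fun a _ => near_open hγ a
  have hUF : ∀ z ∈ U, z ∉ F := by
    intro z hz hzF
    obtain ⟨a, ha, hza⟩ := mem_iUnion₂.mp hz
    obtain ⟨p, hp, rfl⟩ := hF
    have h1 := (near_face γ hp hzF a).mp hza
    rcases h1 with rfl | ⟨e, he, hve, hpe⟩ | ⟨-, hvf⟩
    · exact hp (vmap_mem_total γ a)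
    · exact hp (emap_mem_total γ he hpe)
    · exact hAF a ha hvf
  have hUb : IsBounded U := by
    refine (Metric.isBounded_closedBall (x := (0 : Plane)) (r := R)).subset ?_
    intro z hz
    by_contra hcon
    rw [mem_closedBall_zero_iff, not_le] at hcon
    exact hUF z hz (hFR z hcon)
  have hfr : frontier U ⊆ imSE γ S (edgesIn G S) := by
    intro p hp
    rw [hU.frontier_eq] at hp
    have hS : ∀ b, Near γ p b → b ∈ S := by
      intro b hb
      obtain ⟨z, hz1, hz2⟩ := mem_closure_iff.mp hp.1 _ (near_open hγ b) hb
      obtain ⟨a, ha, hza⟩ := mem_iUnion₂.mp hz2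
      have hbA : b ∉ A := fun h => hp.2 (mem_iUnion₂.mpr ⟨b, h, hb⟩)
      have hab : a ≠ b := by rintro rfl; exact hbA ha
      exact (hN a ha b (near_adj hγ hab hza hz1)).resolve_left hbA
    by_cases hpt : p ∈ γ.totalImage
    · rcases hpt with ⟨v, rfl⟩ | h
      · exact Or.inl ⟨v, hS v (Or.inl rfl), rfl⟩
      · obtain ⟨e, he, hpe⟩ := mem_iUnion₂.mp h
        refine Or.inr (mem_iUnion₂.mpr ⟨e, ⟨he, fun v hv => hS v (Or.inr (Or.inl ⟨e, he, hv, hpe⟩))⟩, hpe⟩)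
    · obtain ⟨z, hz1, hz2⟩ := mem_closure_iff.mp hp.1 _ (faceAt_open γ p) (mem_faceAt γ hpt)
      obtain ⟨a, ha, hza⟩ := mem_iUnion₂.mp hz2
      exact absurd (mem_iUnion₂.mpr ⟨a, ha, (near_face γ hpt hz1 a).mp hza⟩) hp.2
  have hK : IsCompact (imSE γ S (edgesIn G S)) :=
    imSE_compact γ (fun e he => he.1) (fun e he => he.2)
  exact no_log_of_sep hK hUb hfr (mem_iUnion₂.mpr ⟨x, hx, Or.inl rfl⟩) (q := fun _ => 1)
    continuousOn_const (fun _ _ => one_ne_zero) hc (fun z hz => by rw [he z hz, mul_one])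

/-- The unbounded face. -/
lemma exists_outer [Finite V] (γ : Drawing G) :
    ∃ (F : Set Plane) (R : ℝ), (∃ p, p ∉ γ.totalImage ∧ F = faceAt γ p) ∧
      (∀ z : Plane, R < ‖z‖ → z ∈ F) := by
  obtain ⟨R, hR⟩ := (totalImage_compact γ).isBounded.subset_closedBall 0
  let B : Set Plane := (Metric.closedBall (0 : Plane) (max R 0))ᶜ
  have hB : B ⊆ γ.totalImageᶜ := by
    intro z hz hzt
    exact hz (Metric.closedBall_subset_closedBall (le_max_left _ _) (hR hzt))
  have hrk : 1 < Module.rank ℝ Plane := by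
    rw [← Module.finrank_eq_rank]; simp
  have hBp : IsPreconnected B := by
    have h0 : IsPreconnected ({0}ᶜ : Set Plane) :=
      (isConnected_compl_singleton_of_one_lt_rank hrk 0).isPreconnected
    have : B = (fun z : Plane => (1 + max R 0 / ‖z‖) • z) '' {0}ᶜ := by
      ext w
      simp only [B, mem_compl_iff, mem_closedBall_zero_iff, not_le, mem_image, mem_singleton_iff]
      have hm : 0 ≤ max R 0 := le_max_right _ _
      set m := max R 0
      constructor
      · intro hw
        have hw0 : 0 < ‖w‖ := lt_of_le_of_lt hm hw
        have hpos : 0 < 1 - m / ‖w‖ := by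
          rw [sub_pos, div_lt_one hw0]; exact hw
        refine ⟨(1 - m / ‖w‖) • w, ?_, ?_⟩
        · intro h
          rcases smul_eq_zero.mp h with h | h
          · exact hpos.ne' h
          · rw [h, norm_zero] at hw0; exact lt_irrefl _ hw0
        · rw [norm_smul, Real.norm_eq_abs, abs_of_pos hpos, smul_smul]
          have : (1 + m / ((1 - m / ‖w‖) * ‖w‖)) * (1 - m / ‖w‖) = 1 := by
            have h1 : ‖w‖ - m ≠ 0 := (sub_pos.mpr hw).ne'
            have h2 : (1 - m / ‖w‖) * ‖w‖ = ‖w‖ - m := by field_simp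
            rw [h2]; field_simp; ring
          rw [this, one_smul]
      · rintro ⟨z, hz, rfl⟩
        have hz0 : 0 < ‖z‖ := norm_pos_iff.mpr hz
        have : 0 ≤ m / ‖z‖ := by positivity
        rw [norm_smul, Real.norm_eq_abs, abs_of_pos (by positivity)]
        have : (1 + m / ‖z‖) * ‖z‖ = ‖z‖ + m := by field_simp
        rw [this]; linarith
    rw [this]
    refine h0.image _ ?_
    refine ContinuousOn.smul (f := fun z : Plane => 1 + max R 0 / ‖z‖) (g := fun z => z) ?_ continuousOn_id
    apply ContinuousOn.add continuousOn_const
    apply ContinuousOn.div continuousOn_const continuous_norm.continuousOn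
    intro z hz
    exact norm_ne_zero_iff.mpr hz
  let p : Plane := (max R 0 + 1, 0)
  have hpB : p ∈ B := by
    simp only [B, mem_compl_iff, mem_closedBall_zero_iff, not_le]
    have : ‖p‖ = max R 0 + 1 := by
      simp only [p, Prod.norm_def, norm_zero, Real.norm_eq_abs]
      rw [abs_of_pos (by positivity)]
      exact max_eq_left (by positivity)
    rw [this]; linarith
  refine ⟨faceAt γ p, max R 0, ⟨p, hB hpB, rfl⟩, ?_⟩
  intro z hz
  refine hBp.subset_connectedComponentIn hpB hB ?_
  simp only [B, mem_compl_iff, mem_closedBall_zero_iff, not_le]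
  exact hz



/-! ### Part 4: winding sums along walks -/

lemma exists_arcLog (γ : Drawing G) {e : Sym2 V} (he : e ∈ G.edgeSet) {p : Plane}
    (hp : p ∉ carc γ e) : ∃ h : Plane → ℂ, ContinuousOn h (carc γ e) ∧
      ∀ z ∈ carc γ e, Complex.exp (h z) = cz z - cz p := by
  induction e with | _ u v =>
  obtain ⟨f, h1, h2, h3, h4, h6, h5⟩ := carc_param γ he
  rw [h5] at hp ⊢
  let g : Icc (0 : ℝ) 1 → Plane := fun t => f t
  have hgc : Continuous g := continuousOn_iff_continuous_domRestrict.mp h1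
  have hgi : Function.Injective g := fun a b hab => Subtype.ext (h2 a.2 b.2 hab)
  have hge := (hgc.isClosedEmbedding hgi).isEmbedding
  have hr : f '' Icc 0 1 = range g := by
    ext z; constructor
    · rintro ⟨t, ht, rfl⟩; exact ⟨⟨t, ht⟩, rfl⟩
    · rintro ⟨t, rfl⟩; exact ⟨t, t.2, rfl⟩
  rw [hr] at hp ⊢
  let φ := hge.toHomeomorph.symm
  have hφ : ∀ z : range g, g (φ z) = z := by
    intro z
    have := hge.toHomeomorph.apply_symm_apply z
    exact congrArg Subtype.val this
  let g' : unitInterval → Plane := g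
  have hne : ∀ t, cz (g t) - cz p ≠ 0 := fun t => cz_sub_ne (fun h => hp ⟨t, h⟩)
  let t0 : Icc (0 : ℝ) 1 := ⟨0, by simp⟩
  obtain ⟨h, hc, hh⟩ := exists_log_homotopy (A := range g)
    (fun x => (cz (g' (x.1 * φ x.2)) - cz p) / (cz (g t0) - cz p))
    (by
      apply Continuous.div_const
      apply Continuous.sub _ continuous_const
      apply cz_continuous.comp
      apply hgc.comp
      exact continuous_fst.mul (φ.continuous.comp continuous_snd))
    (fun x => div_ne_zero (hne _) (hne _))
    (fun a => by
      have : (0 : unitInterval) * (φ a) = t0 := by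
        apply Subtype.ext; simp [t0]
      simp only [this]
      exact div_self (hne t0))
  refine ⟨fun z => h z + Complex.log (cz (g t0) - cz p), hc.add continuousOn_const, ?_⟩
  intro z hz
  rw [Complex.exp_add, hh z hz, Complex.exp_log (hne t0)]
  simp only [one_mul]
  rw [show g' (φ ⟨z, hz⟩) = z from hφ ⟨z, hz⟩]
  exact div_mul_cancel₀ _ (hne t0)

open Classical in
/-- A chosen logarithm of `z - p` along the closed arc of the edge `e`. -/
def arcLog (γ : Drawing G) (p : Plane) (e : Sym2 V) : Plane → ℂ :=
  if h : ∃ h : Plane → ℂ, ContinuousOn h (carc γ e) ∧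
      ∀ z ∈ carc γ e, Complex.exp (h z) = cz z - cz p then h.choose else 0

lemma arcLog_spec (γ : Drawing G) {e : Sym2 V} (he : e ∈ G.edgeSet) {p : Plane}
    (hp : p ∉ carc γ e) : ContinuousOn (arcLog γ p e) (carc γ e) ∧
      ∀ z ∈ carc γ e, Complex.exp (arcLog γ p e z) = cz z - cz p := by
  have h := exists_arcLog γ he hp
  unfold arcLog
  rw [dif_pos h]
  exact h.choose_spec

/-- The increment of the logarithm of `z - p` along the edge `uv`. -/
def inc (γ : Drawing G) (p : Plane) (u v : V) : ℂ :=
  arcLog γ p s(u, v) (γ.vmap v) - arcLog γ p s(u, v) (γ.vmap u)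

lemma inc_swap (γ : Drawing G) (p : Plane) (u v : V) : inc γ p v u = - inc γ p u v := by
  unfold inc; rw [Sym2.eq_swap]; ring

/-- The total increment of the logarithm of `z - p` along a walk. -/
def wind (γ : Drawing G) (p : Plane) {H : SimpleGraph V} : {u v : V} → H.Walk u v → ℂ
  | _, _, .nil => 0
  | u, _, .cons (v := v) _ q => inc γ p u v + wind γ p q

section
variable (γ : Drawing G) (p : Plane) {H : SimpleGraph V}

@[simp] lemma wind_nil (u : V) : wind γ p (SimpleGraph.Walk.nil : H.Walk u u) = 0 := rfl

@[simp] lemma wind_cons {u v w : V} (h : H.Adj u v) (q : H.Walk v w) :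
    wind γ p (.cons h q) = inc γ p u v + wind γ p q := rfl

@[simp] lemma wind_append {u v w : V} (a : H.Walk u v) (b : H.Walk v w) :
    wind γ p (a.append b) = wind γ p a + wind γ p b := by
  induction a with
  | nil => simp
  | cons h q ih => simp [ih, add_assoc]

@[simp] lemma wind_reverse {u v : V} (a : H.Walk u v) :
    wind γ p a.reverse = - wind γ p a := by
  induction a with
  | nil => simp
  | @cons a b c h q ih => simp [ih, inc_swap γ p a b, add_comm]

lemma wind_rotate [DecidableEq V] {u v : V} (c : H.Walk v v) (h : u ∈ c.support) :
    wind γ p (c.rotate u h) = wind γ p c := by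
  have h1 := congrArg (wind γ p) (c.take_spec h)
  rw [wind_append] at h1
  rw [SimpleGraph.Walk.rotate, wind_append, add_comm, h1]

lemma wind_mapLe {H' : SimpleGraph V} (hle : H ≤ H') {u v : V} (a : H.Walk u v) :
    wind γ p (a.mapLe hle) = wind γ p a := by
  induction a with
  | nil => rfl
  | cons h q ih =>
    change inc γ p _ _ + wind γ p (q.mapLe hle) = _
    rw [ih]; rfl

lemma path_single {u v : V} (r : H.Walk v u) (hr : r.IsPath) (he : s(u, v) ∈ r.edges) :
    wind γ p r = inc γ p v u := by
  cases r with
  | nil => simp at he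
  | cons h q =>
    rename_i w
    rw [SimpleGraph.Walk.cons_isPath_iff] at hr
    rw [SimpleGraph.Walk.edges_cons, List.mem_cons] at he
    rcases he with he | he
    · have hw : w = u := by
        have : u ∈ s(v, w) := by rw [← he]; simp
        rcases Sym2.mem_iff.mp this with h1 | h1
        · have h2 : w ∈ s(u, v) := by rw [he]; simp
          rcases Sym2.mem_iff.mp h2 with h3 | h3
          · exact h3
          · rw [h3, h1]
        · exact h1.symm
      subst hw
      have := SimpleGraph.Walk.eq_nil_iff_nil.mpr (SimpleGraph.Walk.isPath_iff_nil.mp hr.1)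
      subst this
      simp
    · exact absurd (q.snd_mem_support_of_mem_edges he) hr.2

/-- If all cycles have winding sum zero, then winding sums only depend on the bypass. -/
lemma wind_bypass [DecidableEq V]
    (hcyc : ∀ (u : V) (c : H.Walk u u), c.IsCycle → wind γ p c = 0) {u v : V} (w : H.Walk u v) :
    wind γ p w = wind γ p w.bypass := by
  induction w with
  | nil => rfl
  | @cons u v w h q ih =>
    rw [wind_cons, ih, SimpleGraph.Walk.bypass]
    split_ifs with hs
    · conv_lhs => rw [← q.bypass.take_spec hs, wind_append]
      have hp : (q.bypass.takeUntil u hs).IsPath := q.bypass_isPath.takeUntil hs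
      have key : inc γ p u v + wind γ p (q.bypass.takeUntil u hs) = 0 := by
        by_cases he : s(u, v) ∈ (q.bypass.takeUntil u hs).edges
        · rw [path_single γ p _ hp he, inc_swap]; ring
        · have := hcyc u (.cons h (q.bypass.takeUntil u hs))
            (SimpleGraph.Walk.cons_isCycle_iff _ _ |>.mpr ⟨hp, he⟩)
          simpa using this
      rw [← add_assoc, key, zero_add]
    · rfl

lemma wind_closed [DecidableEq V]
    (hcyc : ∀ (u : V) (c : H.Walk u u), c.IsCycle → wind γ p c = 0) {u : V} (w : H.Walk u u) :
    wind γ p w = 0 := by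
  rw [wind_bypass γ p hcyc, SimpleGraph.Walk.eq_nil_iff_nil.mpr (SimpleGraph.Walk.isPath_iff_nil.mp w.bypass_isPath)]; rfl

lemma exp_inc {u v : V} (h : G.Adj u v) (hp : p ∉ carc γ s(u, v)) :
    Complex.exp (inc γ p u v) * (cz (γ.vmap u) - cz p) = cz (γ.vmap v) - cz p := by
  obtain ⟨-, h2⟩ := arcLog_spec γ h hp
  have hu := h2 _ (vmap_mem_carc γ (Sym2.mem_mk_left u v))
  have hv := h2 _ (vmap_mem_carc γ (Sym2.mem_mk_right u v))
  rw [inc, Complex.exp_sub, ← hu, ← hv]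
  exact div_mul_cancel₀ _ (Complex.exp_ne_zero _)

lemma exp_wind (hH : H ≤ G) (hp : ∀ e ∈ H.edgeSet, p ∉ carc γ e) {u v : V} (w : H.Walk u v) :
    Complex.exp (wind γ p w) * (cz (γ.vmap u) - cz p) = cz (γ.vmap v) - cz p := by
  induction w with
  | nil => simp
  | cons h q ih =>
    rw [wind_cons, Complex.exp_add, mul_comm (Complex.exp (inc γ p _ _)), mul_assoc,
      exp_inc γ p (hH h) (hp _ h), ih]

end

/-- The graph `G` with only the edges inside `S`. -/
def inS (G : SimpleGraph V) (S : Set V) : SimpleGraph V where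
  Adj a b := G.Adj a b ∧ a ∈ S ∧ b ∈ S
  symm := ⟨fun _ _ h => ⟨h.1.symm, h.2.2, h.2.1⟩⟩
  loopless := ⟨fun _ h => h.1.ne rfl⟩

lemma inS_le (S : Set V) : inS G S ≤ G := fun _ _ h => h.1

lemma mem_inS_edgeSet {S : Set V} {e : Sym2 V} : e ∈ (inS G S).edgeSet ↔ e ∈ edgesIn G S := by
  induction e with | _ u v => simp [inS, edgesIn]

/-- If all cycles inside `S` have zero winding sum around `p`, there is a logarithm. -/
lemma exists_log_imSE [Finite V] {γ : Drawing G} (h0 : γ.crossings = ∅) {S : Set V} {p : Plane}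
    (hp : p ∉ imSE γ S (edgesIn G S))
    (hcyc : ∀ (u : V) (c : (inS G S).Walk u u), c.IsCycle → wind γ p c = 0) :
    ∃ h : Plane → ℂ, ContinuousOn h (imSE γ S (edgesIn G S)) ∧
      ∀ z ∈ imSE γ S (edgesIn G S), Complex.exp (h z) = cz z - cz p := by
  classical
  have heq := imSE_eq γ (S := S) (E := edgesIn G S) (fun e he => he.2)
  have hsub : ∀ e ∈ edgesIn G S, carc γ e ⊆ imSE γ S (edgesIn G S) := by
    intro e he
    rw [heq]
    exact subset_union_of_subset_right (subset_biUnion_of_mem (u := fun e => carc γ e) he) _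
  have hpc : ∀ e ∈ edgesIn G S, p ∉ carc γ e := fun e he h => hp (hsub e he h)
  have hrep : ∀ v : V, ∃ r : V, ∃ w : (inS G S).Walk r v,
      r = ((inS G S).connectedComponentMk v).out := by
    intro v
    have : (inS G S).Reachable ((inS G S).connectedComponentMk v).out v :=
      SimpleGraph.ConnectedComponent.exact (Quot.out_eq _)
    obtain ⟨w⟩ := this
    exact ⟨_, w, rfl⟩
  choose r w hr using hrep
  have hpv : ∀ v ∈ S, cz (γ.vmap v) - cz p ≠ 0 := by
    intro v hv
    apply cz_sub_ne
    intro h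
    exact hp (h ▸ Or.inl ⟨v, hv, rfl⟩)
  let φ : V → ℂ := fun v => Complex.log (cz (γ.vmap (r v)) - cz p) + wind γ p (w v)
  have hφ : ∀ u v, (inS G S).Adj u v → φ v - φ u = inc γ p u v := by
    intro u v huv
    have hrr : r u = r v := by
      rw [hr u, hr v]
      congr 1
      exact SimpleGraph.ConnectedComponent.sound huv.reachable
    have := wind_closed γ p hcyc (((w u).append (.cons huv (w v).reverse)).copy rfl hrr.symm)
    have h2 : ∀ {a b c : V} (x : (inS G S).Walk a b) (h : b = c), wind γ p (x.copy rfl h) = wind γ p x := by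
      rintro a b c x rfl; rfl
    rw [h2] at this
    simp only [wind_append, wind_cons, wind_reverse] at this
    simp only [φ, hrr]
    linear_combination -this
  have hφe : ∀ v ∈ S, Complex.exp (φ v) = cz (γ.vmap v) - cz p := by
    intro v hv
    simp only [φ]
    have h1 := exp_wind γ p (inS_le S) (fun e he => hpc e (mem_inS_edgeSet.mp he)) (w v)
    have h2 : cz (γ.vmap (r v)) - cz p ≠ 0 := by
      intro h
      rw [h, mul_zero] at h1
      exact hpv v hv h1.symm
    rw [Complex.exp_add, Complex.exp_log h2, mul_comm, h1]
  have hconst : ∀ e ∈ edgesIn G S, ∃ c : ℂ, ∀ v ∈ e, φ v - arcLog γ p e (γ.vmap v) = c := by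
    intro e he
    induction e with | _ u v =>
    refine ⟨φ u - arcLog γ p s(u, v) (γ.vmap u), ?_⟩
    intro x hx
    rcases Sym2.mem_iff.mp hx with rfl | rfl
    · rfl
    · have := hφ u x ⟨he.1, he.2 u (by simp), he.2 x (by simp)⟩
      rw [inc] at this
      linear_combination this
  choose! c hcst using hconst
  let h : Plane → ℂ := fun z => if hz : ∃ v ∈ S, γ.vmap v = z then φ hz.choose else
    if hz : ∃ e ∈ edgesIn G S, z ∈ γ.emap e then arcLog γ p hz.choose z + c hz.choose else 0
  have hv : ∀ v ∈ S, h (γ.vmap v) = φ v := by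
    intro v hvS
    have hz : ∃ x ∈ S, γ.vmap x = γ.vmap v := ⟨v, hvS, rfl⟩
    simp only [h]
    rw [dif_pos hz, γ.vmap_inj hz.choose_spec.2]
  have hcarc : ∀ e ∈ edgesIn G S, ∀ z ∈ carc γ e, h z = arcLog γ p e z + c e := by
    rintro e he z (hz | ⟨v, hve, rfl⟩)
    · have h1 : ¬ ∃ v ∈ S, γ.vmap v = z := by
        rintro ⟨v, -, rfl⟩
        exact γ.avoid e he.1 v hz
      have h2 : ∃ e ∈ edgesIn G S, z ∈ γ.emap e := ⟨e, he, hz⟩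
      simp only [h]
      rw [dif_neg h1, dif_pos h2]
      rw [emap_inj_of_planar h0 h2.choose_spec.1.1 he.1 h2.choose_spec.2 hz]
    · rw [hv v (he.2 v hve), ← hcst e he v hve]; ring
  refine ⟨h, ?_, ?_⟩
  · rw [heq]
    have hfin : (γ.vmap '' S).Finite := (Set.toFinite S).image _
    apply ContinuousOn.union_of_isClosed
    · exact hfin.continuousOn _
    · rw [biUnion_eq_iUnion]
      apply (locallyFinite_of_finite _).continuousOn_iUnion
      · exact fun e => (carc_compact γ e.2.1).isClosed
      · intro e
        exact ((arcLog_spec γ e.2.1 (hpc _ e.2)).1.add continuousOn_const).congr (hcarc _ e.2)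
    · exact hfin.isClosed
    · exact ((Set.toFinite _).isCompact_biUnion fun e he => carc_compact γ he.1).isClosed
  · intro z hz
    rw [heq] at hz
    rcases hz with ⟨v, hvS, rfl⟩ | hz
    · rw [hv v hvS, hφe v hvS]
    · obtain ⟨e, he, hze⟩ := mem_iUnion₂.mp hz
      obtain ⟨l1, l2⟩ := arcLog_spec γ he.1 (hpc e he)
      have hc1 : Complex.exp (c e) = 1 := by
        induction e with | _ u v =>
        have hu : u ∈ s(u, v) := by simp
        rw [← hcst _ he u hu, Complex.exp_sub, hφe u (he.2 u hu), l2 _ (vmap_mem_carc γ hu)]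
        exact div_self (hpv u (he.2 u hu))
      rw [hcarc e he z hze, Complex.exp_add, hc1, mul_one, l2 z hze]

/-- Comparison of winding sums around two points. -/
lemma wind_sub_wind {γ : Drawing G} {K : Set Plane} {p q : Plane} (hp : p ∉ K) (hq : q ∉ K)
    {h : Plane → ℂ} (hc : ContinuousOn h K)
    (he : ∀ z ∈ K, Complex.exp (h z) = (cz z - cz p) / (cz z - cz q)) {u v : V} (w : G.Walk u v)
    (hw : ∀ e ∈ w.edges, carc γ e ⊆ K) :
    wind γ p w - wind γ q w = h (γ.vmap v) - h (γ.vmap u) := by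
  induction w with
  | nil => simp
  | @cons u v w ha r ih =>
    have ih' := ih (fun e he => hw e (by simp [he]))
    have hs := hw s(u, v) (by simp)
    obtain ⟨p1, p2⟩ := arcLog_spec γ (e := s(u, v)) ha (fun h => hp (hs h))
    obtain ⟨q1, q2⟩ := arcLog_spec γ (e := s(u, v)) ha (fun h => hq (hs h))
    have := exp_const_of_preconnected (carc_preconnected γ (e := s(u, v)) ha) (p1.sub q1) (hc.mono hs)
      (fun z hz => by
        rw [Pi.sub_apply, Complex.exp_sub, p2 z hz, q2 z hz, he z (hs hz)])
      (vmap_mem_carc γ (Sym2.mem_mk_left u v)) (vmap_mem_carc γ (Sym2.mem_mk_right u v))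
    simp only [wind_cons, inc]
    simp only [Pi.sub_apply] at this
    linear_combination ih' - this

lemma wind_eq_sub {γ : Drawing G} {K : Set Plane} {p : Plane} (hp : p ∉ K)
    {h : Plane → ℂ} (hc : ContinuousOn h K)
    (he : ∀ z ∈ K, Complex.exp (h z) = (cz z - cz p)) {u v : V} (w : G.Walk u v)
    (hw : ∀ e ∈ w.edges, carc γ e ⊆ K) :
    wind γ p w = h (γ.vmap v) - h (γ.vmap u) := by
  induction w with
  | nil => simp
  | @cons u v w ha r ih =>
    have ih' := ih (fun e he => hw e (by simp [he]))
    have hs := hw s(u, v) (by simp)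
    obtain ⟨p1, p2⟩ := arcLog_spec γ (e := s(u, v)) ha (fun h => hp (hs h))
    have := exp_const_of_preconnected (carc_preconnected γ (e := s(u, v)) ha) p1 (hc.mono hs)
      (fun z hz => by rw [p2 z hz, he z (hs hz)])
      (vmap_mem_carc γ (Sym2.mem_mk_left u v)) (vmap_mem_carc γ (Sym2.mem_mk_right u v))
    simp only [wind_cons, inc]
    linear_combination ih' - this

lemma wind_eq_of_joined {γ : Drawing G} {K : Set Plane} {p q : Plane} (hpq : JoinedIn Kᶜ p q)
    {u : V} (w : G.Walk u u) (hw : ∀ e ∈ w.edges, carc γ e ⊆ K) : wind γ p w = wind γ q w := by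
  obtain ⟨h, hc, he⟩ := exists_log_path hpq
  have := wind_sub_wind hpq.source_mem hpq.target_mem hc he w hw
  rw [sub_self] at this
  exact sub_eq_zero.mp this

lemma norm_le_cz (z : Plane) : ‖z‖ ≤ ‖cz z‖ := by
  rw [Prod.norm_def]
  exact max_le (Complex.abs_re_le_norm (cz z)) (Complex.abs_im_le_norm (cz z))

lemma cz_le_norm (z : Plane) : ‖cz z‖ ≤ 2 * ‖z‖ := by
  have h1 : |(cz z).re| ≤ ‖z‖ := norm_fst_le z
  have h2 : |(cz z).im| ≤ ‖z‖ := norm_snd_le z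
  linarith [Complex.norm_le_abs_re_add_abs_im (cz z)]

/-- Points with nonzero winding sum lie in a bounded complementary component. -/
lemma bounded_of_wind {γ : Drawing G} {K : Set Plane} (hK : IsCompact K) {p : Plane} (hp : p ∉ K)
    {u : V} (w : G.Walk u u) (hw : ∀ e ∈ w.edges, carc γ e ⊆ K) (hne : wind γ p w ≠ 0) :
    IsBounded (connectedComponentIn Kᶜ p) := by
  by_contra hb
  obtain ⟨R, hR⟩ := hK.isBounded.subset_closedBall 0
  have : ∃ q ∈ connectedComponentIn Kᶜ p, 2 * |R| < ‖q‖ := by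
    by_contra hcon
    push Not at hcon
    apply hb
    refine (Metric.isBounded_closedBall (x := (0 : Plane)) (r := 2 * |R|)).subset ?_
    intro z hz
    rw [mem_closedBall_zero_iff]
    exact hcon z hz
  obtain ⟨q, hq, hqR⟩ := this
  have hop : IsOpen (connectedComponentIn Kᶜ p) := hK.isClosed.isOpen_compl.connectedComponentIn
  have hpc : IsPathConnected (connectedComponentIn Kᶜ p) :=
    hop.isConnected_iff_isPathConnected.mp (isConnected_connectedComponentIn_iff.mpr hp)
  have hj : JoinedIn Kᶜ p q :=
    (hpc.joinedIn p (mem_connectedComponentIn hp) q hq).mono (connectedComponentIn_subset _ _)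
  rw [wind_eq_of_joined hj w hw] at hne
  have hq0 : cz q ≠ 0 := by
    intro h
    have := norm_le_cz q
    rw [h, norm_zero] at this
    linarith [abs_nonneg R]
  have hslit : ∀ z ∈ K, 1 - cz z / cz q ∈ Complex.slitPlane := by
    intro z hz
    left
    have h1 : ‖cz z / cz q‖ < 1 := by
      rw [norm_div, div_lt_one (norm_pos_iff.mpr hq0)]
      have hzR : ‖z‖ ≤ R := mem_closedBall_zero_iff.mp (hR hz)
      have := cz_le_norm z
      have := norm_le_cz q
      have := le_abs_self R
      linarith
    have h2 := Complex.re_le_norm (cz z / cz q)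
    rw [Complex.sub_re, Complex.one_re]
    linarith
  apply hne
  have hc : ContinuousOn (fun z => Complex.log (1 - cz z / cz q) + Complex.log (- cz q)) K := by
    refine ContinuousOn.add ?_ continuousOn_const
    refine ContinuousOn.clog ?_ hslit
    exact (continuous_const.sub (cz_continuous.div_const _)).continuousOn
  have := wind_eq_sub (γ := γ) hj.target_mem hc (fun z hz => by
    rw [Complex.exp_add, Complex.exp_log (Complex.slitPlane_ne_zero (hslit z hz)),
      Complex.exp_log (neg_ne_zero.mpr hq0)]
    field_simp; ring) w hw
  rw [this, sub_self]



/-! ### Part 5: cycles and nests -/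

lemma inS_support {S : Set V} {u v : V} (w : (inS G S).Walk u v) (hu : u ∈ S) :
    ∀ x ∈ w.support, x ∈ S := by
  induction w with
  | nil => intro x hx; simp at hx; rwa [hx]
  | cons h q ih =>
    intro x hx
    rw [SimpleGraph.Walk.support_cons, List.mem_cons] at hx
    rcases hx with rfl | hx
    · exact hu
    · exact ih h.2.2 x hx

lemma exists_cycle_cut [Finite V] {γ : Drawing G} (hγ : γ.IsPlaneTriangulation) {A S : Set V} {x : V}
    (hx : x ∈ A) (hxS : x ∉ S) (hN : ∀ a ∈ A, ∀ b, G.Adj a b → b ∈ A ∨ b ∈ S)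
    {F : Set Plane} (hF : ∃ p, p ∉ γ.totalImage ∧ F = faceAt γ p)
    {R : ℝ} (hFR : ∀ z : Plane, R < ‖z‖ → z ∈ F)
    (hAF : ∀ a ∈ A, γ.vmap a ∉ frontier F) :
    ∃ (u : V) (c : G.Walk u u), c.IsCycle ∧ (∀ v ∈ c.support, v ∈ S) ∧
      wind γ (γ.vmap x) c ≠ 0 := by
  by_contra hcon
  push Not at hcon
  have hxim : γ.vmap x ∉ imSE γ S (edgesIn G S) := by
    rw [vmap_mem_imSE γ (fun e he => he.1)]; exact hxS
  obtain ⟨h, hc, he⟩ := exists_log_imSE hγ.1 hxim (by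
    intro u c hcyc
    rw [← wind_mapLe γ _ (inS_le S)]
    apply hcon u _ (hcyc.mapLe (inS_le S))
    intro v hv
    have huS : u ∈ S := by
      cases c with
      | nil => exact absurd hcyc.ne_nil (by simp)
      | cons h q => exact h.2.1
    refine inS_support c huS v ?_
    simpa using hv)
  exact no_log_cut hγ hx hN hF hFR hAF hc he

section
variable [Finite V] {γ : Drawing G}

lemma carc_subset_walk (γ : Drawing G) {u v : V} (c : G.Walk u v) :
    ∀ e ∈ c.edges, carc γ e ⊆ γ.image c.toSubgraph := by
  intro e he
  rw [← SimpleGraph.Walk.mem_edges_toSubgraph] at he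
  apply union_subset
  · exact fun z hz => Or.inr (mem_iUnion₂.mpr ⟨e, he, hz⟩)
  · rintro _ ⟨v, hv, rfl⟩
    exact Or.inl ⟨v, c.toSubgraph.mem_verts_of_mem_edge he hv, rfl⟩

lemma vmap_mem_walk (γ : Drawing G) {u v : V} (c : G.Walk u v) {x : V} :
    γ.vmap x ∈ γ.image c.toSubgraph ↔ x ∈ c.support := by
  rw [image_eq_imSE, vmap_mem_imSE γ c.toSubgraph.edgeSet_subset,
    SimpleGraph.Walk.mem_verts_toSubgraph]

lemma emap_mem_walk (h0 : γ.crossings = ∅) {u v : V} (c : G.Walk u v) {e : Sym2 V}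
    (he : e ∈ G.edgeSet) {z : Plane} (hz : z ∈ γ.emap e) (h : z ∈ γ.image c.toSubgraph) :
    e ∈ c.edges := by
  rw [← SimpleGraph.Walk.mem_edges_toSubgraph]
  exact emap_mem_imSE h0 c.toSubgraph.edgeSet_subset he hz h

lemma wind_adj (h0 : γ.crossings = ∅) {u : V} (c : G.Walk u u) {a b : V} (hab : G.Adj a b)
    (ha : a ∉ c.support) (hb : b ∉ c.support) : wind γ (γ.vmap a) c = wind γ (γ.vmap b) c := by
  refine wind_eq_of_joined (K := γ.image c.toSubgraph) ?_ c (carc_subset_walk γ c)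
  refine (carc_joined γ hab).mono ?_
  rintro z (hz | ⟨x, hx, rfl⟩) hK
  · exact ha (c.fst_mem_support_of_mem_edges (emap_mem_walk h0 c hab hz hK))
  · rw [vmap_mem_walk] at hK
    rcases Sym2.mem_iff.mp hx with rfl | rfl
    · exact ha hK
    · exact hb hK

lemma wind_reach (h0 : γ.crossings = ∅) {u : V} (c : G.Walk u u) {H : SimpleGraph V} (hH : H ≤ G)
    {a b : V} (w : H.Walk a b)
    (hw : ∀ v ∈ w.support, v ∉ c.support) : wind γ (γ.vmap a) c = wind γ (γ.vmap b) c := by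
  induction w with
  | nil => rfl
  | cons h q ih =>
    rw [wind_adj h0 c (hH h) (hw _ (by simp)) (hw _ (by simp)), ih (fun v hv => hw v (by simp [hv]))]

lemma wind_outer {u : V} (c : G.Walk u u) {F : Set Plane}
    (hF : ∃ p, p ∉ γ.totalImage ∧ F = faceAt γ p)
    {R : ℝ} (hFR : ∀ z : Plane, R < ‖z‖ → z ∈ F) {y : V} (hy : γ.vmap y ∈ frontier F)
    (hyc : y ∉ c.support) : wind γ (γ.vmap y) c = 0 := by
  by_contra hne
  have hyK : γ.vmap y ∉ γ.image c.toSubgraph := by rwa [vmap_mem_walk]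
  have hb := bounded_of_wind (image_compact γ c.toSubgraph) hyK c (carc_subset_walk γ c) hne
  set N := connectedComponentIn (γ.image c.toSubgraph)ᶜ (γ.vmap y) with hN
  have hNo : IsOpen N := (image_compact γ c.toSubgraph).isClosed.isOpen_compl.connectedComponentIn
  obtain ⟨z, hz1, hz2⟩ := mem_closure_iff.mp (frontier_subset_closure hy) N hNo
    (mem_connectedComponentIn hyK)
  have hFN : F ⊆ N := by
    rw [hN, connectedComponentIn_eq hz1]
    obtain ⟨p, hp, rfl⟩ := hF
    refine isPreconnected_connectedComponentIn.subset_connectedComponentIn hz2 ?_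
    exact (connectedComponentIn_subset _ _).trans
      (compl_subset_compl.mpr (image_subset_totalImage γ _))
  obtain ⟨r, hr⟩ := hb.subset_closedBall 0
  have hq : ((|R| + |r| + 1, 0) : Plane) ∈ Metric.closedBall (0 : Plane) r := by
    apply hr; apply hFN; apply hFR
    rw [Prod.norm_def]
    refine lt_of_lt_of_le ?_ (le_max_left _ _)
    rw [Real.norm_eq_abs, abs_of_pos (by positivity)]
    linarith [le_abs_self R, abs_nonneg r]
  rw [mem_closedBall_zero_iff] at hq
  have h1 := (norm_fst_le ((|R| + |r| + 1, 0) : Plane)).trans hq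
  rw [Real.norm_eq_abs, abs_of_pos (by positivity)] at h1
  linarith [le_abs_self r, abs_nonneg R]

lemma image_subset_closedRegion (h0 : γ.crossings = ∅) {u u' : V} (c : G.Walk u u)
    (c' : G.Walk u' u')
    (h1 : ∀ v ∈ c'.support, v ∉ c.support → wind γ (γ.vmap v) c ≠ 0)
    (h2 : ∀ e ∈ c'.edges, ∃ v ∈ e, v ∉ c.support) :
    γ.image c'.toSubgraph ⊆ closedRegion (γ.image c.toSubgraph) := by
  intro z hz
  by_cases hzK : z ∈ γ.image c.toSubgraph
  · exact Or.inl hzK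
  refine Or.inr ⟨hzK, ?_⟩
  refine bounded_of_wind (image_compact γ c.toSubgraph) hzK c (carc_subset_walk γ c) ?_
  rcases hz with ⟨v, hv, rfl⟩ | hz
  · rw [SimpleGraph.Walk.mem_verts_toSubgraph] at hv
    rw [vmap_mem_walk] at hzK
    exact h1 v hv hzK
  · obtain ⟨e, he, hze⟩ := mem_iUnion₂.mp hz
    rw [SimpleGraph.Walk.mem_edges_toSubgraph] at he
    obtain ⟨v, hve, hvc⟩ := h2 e he
    obtain ⟨w, rfl⟩ := Sym2.mem_iff_exists.mp hve
    have heG : s(v, w) ∈ G.edgeSet := c'.edges_subset_edgeSet he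
    have hj : JoinedIn (γ.image c.toSubgraph)ᶜ z (γ.vmap v) := by
      refine (emap_joined γ heG hze).mono ?_
      rintro q (hq | hq) hqK
      · exact hvc (c.fst_mem_support_of_mem_edges (emap_mem_walk h0 c heG hq hqK))
      · rw [mem_singleton_iff.mp hq, vmap_mem_walk] at hqK
        exact hvc hqK
    rw [wind_eq_of_joined hj c (carc_subset_walk γ c)]
    exact h1 v (c'.fst_mem_support_of_mem_edges he) hvc

lemma cycle_subgraph {u : V} (c : G.Walk u u) (hc : c.IsCycle) : IsCycleSubgraph c.toSubgraph := by
  refine ⟨c.toSubgraph_connected, Set.toFinite _, ?_⟩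
  intro v hv
  rw [SimpleGraph.Walk.mem_verts_toSubgraph] at hv
  exact hc.ncard_neighborSet_toSubgraph_eq_two hv

/-- Assembling a nest from cycles. -/
lemma snest_of_cycles (h0 : γ.crossings = ∅) {k : ℕ} (X : Finset V) (u : Fin k → V)
    (c : ∀ i, G.Walk (u i) (u i)) (hc : ∀ i, (c i).IsCycle)
    (hX : ∀ i, ∀ v ∈ X, v ∈ (c i).support)
    (hdis : ∀ i j, i ≠ j → ∀ v, v ∈ (c i).support → v ∈ (c j).support → v ∈ X)
    (hw : ∀ i j, i < j → ∀ v ∈ (c j).support, v ∉ X → wind γ (γ.vmap v) (c i) ≠ 0)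
    (he : ∀ i, ∀ e ∈ (c i).edges, ∃ v ∈ e, v ∉ X) :
    γ.IsSNest X.card (fun i => (c i).toSubgraph) := by
  refine ⟨⟨fun i => cycle_subgraph _ (hc i), ?_, ?_, ?_⟩, (X : Set V), X.finite_toSet,
    ncard_coe_finset X, ?_⟩
  · intro i j hij
    rw [Set.disjoint_left]
    intro e h1 h2
    rw [SimpleGraph.Walk.mem_edges_toSubgraph] at h1 h2
    obtain ⟨v, hv, hvX⟩ := he i e h1
    obtain ⟨w, rfl⟩ := Sym2.mem_iff_exists.mp hv
    exact hvX (hdis i j hij v ((c i).fst_mem_support_of_mem_edges h1)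
      ((c j).fst_mem_support_of_mem_edges h2))
  · intro i e h1 e' h2 hne
    rw [← disjoint_iff_inter_eq_empty, Set.disjoint_left]
    intro z hz hz'
    exact hne (emap_inj_of_planar h0 ((c i).toSubgraph.edgeSet_subset h1) h2 hz hz')
  · intro i h
    have hlt : (⟨i, by omega⟩ : Fin k) < ⟨i + 1, h⟩ := by simp [Fin.lt_def]
    apply image_subset_closedRegion h0
    · intro v hv hvn
      exact hw _ _ hlt v hv (fun hh => hvn (hX _ v hh))
    · intro e hee
      obtain ⟨v, hv, hvX⟩ := he _ e hee
      obtain ⟨w, rfl⟩ := Sym2.mem_iff_exists.mp hv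
      exact ⟨v, hv, fun hh => hvX (hdis _ _ hlt.ne v hh ((c _).fst_mem_support_of_mem_edges hee))⟩
  · intro i j hij
    ext v
    simp only [mem_inter_iff, SimpleGraph.Walk.mem_verts_toSubgraph, Finset.mem_coe]
    exact ⟨fun h => hdis i j hij v h.1 h.2, fun h => ⟨hX i v h, hX j v h⟩⟩

end



lemma dart_fst_ne {x a : V} (q : G.Walk x a) (hq : q.IsPath) : ∀ d ∈ q.darts, d.fst ≠ a := by
  induction q with
  | nil => simp
  | cons h r ih =>
    rw [SimpleGraph.Walk.cons_isPath_iff] at hq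
    intro d hd
    rw [SimpleGraph.Walk.darts_cons, List.mem_cons] at hd
    rcases hd with rfl | hd
    · rintro rfl
      exact hq.2 r.end_mem_support
    · exact ih hq.1 d hd

/-- Opening a cycle at a given edge. -/
lemma cycle_open (γ : Drawing G) {u : V} (c : G.Walk u u) (hc : c.IsCycle) {a b : V}
    (h : s(a, b) ∈ c.edges) :
    ∃ P : G.Walk b a, P.IsPath ∧ s(a, b) ∉ P.edges ∧ (∀ v, v ∈ P.support ↔ v ∈ c.support) ∧
      ∃ ε : ℂ, (ε = 1 ∨ ε = -1) ∧ ∀ p, inc γ p a b + wind γ p P = ε * wind γ p c := by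
  classical
  have main : ∀ (c : G.Walk u u), c.IsCycle → (∃ d ∈ c.darts, d.fst = a ∧ d.snd = b) →
      ∃ P : G.Walk b a, P.IsPath ∧ s(a, b) ∉ P.edges ∧ (∀ v, v ∈ P.support ↔ v ∈ c.support) ∧
        ∀ p, inc γ p a b + wind γ p P = wind γ p c := by
    rintro c hc ⟨d, hd, hd1, hd2⟩
    have ha : a ∈ c.support := hd1 ▸ c.dart_fst_mem_support_of_mem_darts hd
    have hrot := hc.rotate ha
    have hw : ∀ p, wind γ p (c.rotate a ha) = wind γ p c := fun p => wind_rotate γ p c ha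
    have hs : ∀ v, v ∈ (c.rotate a ha).support ↔ v ∈ c.support := by
      intro v; simp
    have hd' : d ∈ (c.rotate a ha).darts := (c.rotate_darts a ha).mem_iff.mpr hd
    generalize c.rotate a ha = c' at hrot hw hs hd'
    cases c' with
    | nil => exact absurd hrot.ne_nil (by simp)
    | @cons _ x _ hax q =>
      rw [SimpleGraph.Walk.cons_isCycle_iff] at hrot
      rw [SimpleGraph.Walk.darts_cons, List.mem_cons] at hd'
      rcases hd' with rfl | hd'
      · simp only at hd2
        subst hd2
        refine ⟨q, hrot.1, hrot.2, ?_, fun p => hw p⟩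
        intro v
        rw [← hs v, SimpleGraph.Walk.support_cons, List.mem_cons]
        constructor
        · exact Or.inr
        · rintro (rfl | h)
          · exact q.end_mem_support
          · exact h
      · exact absurd hd1 (dart_fst_ne q hrot.1 d hd')
  obtain ⟨d, hd, hde⟩ := List.mem_map.mp h
  rw [SimpleGraph.dart_edge_eq_mk'_iff'] at hde
  rcases hde with ⟨h1, h2⟩ | ⟨h1, h2⟩
  · obtain ⟨P, p1, p2, p3, p4⟩ := main c hc ⟨d, hd, h1, h2⟩
    exact ⟨P, p1, p2, p3, 1, Or.inl rfl, fun p => by rw [p4, one_mul]⟩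
  · obtain ⟨P, p1, p2, p3, p4⟩ := main c.reverse hc.reverse ⟨d.symm, by simpa using hd, h2, h1⟩
    refine ⟨P, p1, p2, ?_, -1, Or.inr rfl, fun p => ?_⟩
    · intro v; rw [p3]; simp
    · rw [p4, wind_reverse]; ring

section
variable [Finite V] {γ : Drawing G}

lemma outer_adj (hγ : γ.IsPlaneTriangulation) {F : Set Plane}
    (hF : ∃ p, p ∉ γ.totalImage ∧ F = faceAt γ p) {a y : V} (ha : γ.vmap a ∈ frontier F)
    (hy : γ.vmap y ∈ frontier F) (hne : y ≠ a) : G.Adj y a := by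
  obtain ⟨p, hp, rfl⟩ := hF
  exact near_adj (p := p) hγ hne (Or.inr (Or.inr ⟨hp, hy⟩)) (Or.inr (Or.inr ⟨hp, ha⟩))

lemma reach_lemma (hγ : γ.IsPlaneTriangulation) (X : Finset V) (hX : X.card ≤ 2) {F : Set Plane}
    (hF : ∃ p, p ∉ γ.totalImage ∧ F = faceAt γ p)
    {R : ℝ} (hFR : ∀ z : Plane, R < ‖z‖ → z ∈ F) {y : V} (hy : γ.vmap y ∈ frontier F)
    (hyX : y ∉ X) {x : V} (hx : x ∉ X) : (inS G (X : Set V)ᶜ).Reachable y x := by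
  classical
  by_contra hnr
  obtain ⟨u, c, hc, hcs, -⟩ := exists_cycle_cut hγ (A := {v | v ∉ X ∧ ¬ (inS G (X : Set V)ᶜ).Reachable y v})
    (S := X) (x := x) ⟨hx, hnr⟩ hx (by
      rintro a ⟨haX, har⟩ b hab
      by_cases hb : b ∈ X
      · exact Or.inr hb
      · refine Or.inl ⟨hb, fun hr => har (hr.trans ?_)⟩
        exact SimpleGraph.Adj.reachable (G := inS G (X : Set V)ᶜ) ⟨hab.symm, hb, haX⟩) hF hFR (by
      rintro a ⟨haX, har⟩ haF
      by_cases hya : y = a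
      · subst hya; exact har (SimpleGraph.Reachable.refl _)
      · exact har (SimpleGraph.Adj.reachable (G := inS G (X : Set V)ᶜ)
          ⟨outer_adj hγ hF haF hy hya, hyX, haX⟩))
  have h3 := hc.three_le_length
  have hnd := hc.support_nodup
  have h1 : c.support.tail.toFinset ⊆ X := by
    intro v hv
    exact hcs v (List.mem_of_mem_tail (List.mem_toFinset.mp hv))
  have h2 := Finset.card_le_card h1
  rw [List.toFinset_card_of_nodup hnd, List.length_tail, SimpleGraph.Walk.length_support] at h2
  omega

lemma dist_step {H : SimpleGraph V} {y a b : V} (hr : H.Reachable y a) (hab : H.Adj a b) :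
    H.dist y b ≤ H.dist y a + 1 := by
  obtain ⟨w, hw⟩ := hr.exists_walk_length_eq_dist
  have := SimpleGraph.dist_le (w.concat hab)
  rwa [SimpleGraph.Walk.length_concat, hw] at this

lemma layers (hγ : γ.IsPlaneTriangulation) (X : Finset V) (hX : X.card ≤ 2) {F : Set Plane}
    (hF : ∃ p, p ∉ γ.totalImage ∧ F = faceAt γ p)
    {R : ℝ} (hFR : ∀ z : Plane, R < ‖z‖ → z ∈ F) {y : V} (hy : γ.vmap y ∈ frontier F)
    (hyX : y ∉ X) {x : V} (hx : x ∉ X) {M : ℕ} (hM : M < (inS G (X : Set V)ᶜ).dist y x) :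
    ∃ (u : Fin M → V) (c : ∀ j, G.Walk (u j) (u j)), (∀ j, (c j).IsCycle) ∧
      (∀ i j, i ≠ j → ∀ v, v ∈ (c i).support → v ∈ (c j).support → v ∈ X) ∧
      (∀ i j, i < j → ∀ v ∈ (c j).support, v ∉ X → wind γ (γ.vmap v) (c i) ≠ 0) ∧
      (∀ i j, i < j → ∀ v ∈ (c i).support, v ∉ X → wind γ (γ.vmap v) (c j) = 0) := by
  classical
  set H := inS G (X : Set V)ᶜ with hH
  have hreach : ∀ v, v ∉ X → H.Reachable y v := fun v hv => reach_lemma hγ X hX hF hFR hy hyX hv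
  let d : V → ℕ := fun v => H.dist y v
  have hHadj : ∀ {a b}, G.Adj a b → a ∉ X → b ∉ X → H.Adj a b := fun h ha hb => ⟨h, ha, hb⟩
  have hstep : ∀ {a b}, G.Adj a b → a ∉ X → b ∉ X → d b ≤ d a + 1 := fun h ha hb =>
    dist_step (hreach _ ha) (hHadj h ha hb)
  have hdy : d y = 0 := SimpleGraph.dist_self
  have hex : ∀ j : Fin M, ∃ (u : V) (c : G.Walk u u), c.IsCycle ∧
      (∀ v ∈ c.support, v ∈ X ∨ (v ∉ X ∧ d v = j + 1 ∧ ∃ a, G.Adj a v ∧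
        (inS G {v | v ∉ X ∧ j + 1 < d v}).Reachable x a)) ∧ wind γ (γ.vmap x) c ≠ 0 := by
    intro j
    have hxS : x ∈ {v | v ∉ X ∧ j + 1 < d v} := ⟨hx, lt_of_le_of_lt j.2 hM⟩
    have hA : ∀ a, (inS G {v | v ∉ X ∧ j + 1 < d v}).Reachable x a → a ∉ X ∧ j + 1 < d a := by
      rintro a ⟨w⟩
      exact inS_support w hxS a w.end_mem_support
    refine exists_cycle_cut hγ (A := {a | (inS G {v | v ∉ X ∧ j + 1 < d v}).Reachable x a})
      (S := {v | v ∈ X ∨ (v ∉ X ∧ d v = j + 1 ∧ ∃ a, G.Adj a v ∧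
        (inS G {v | v ∉ X ∧ j + 1 < d v}).Reachable x a)}) (SimpleGraph.Reachable.refl _) ?_ ?_ hF hFR ?_
    · rintro (h | ⟨-, h, -⟩)
      · exact hx h
      · have := hxS.2; omega
    · intro a ha b hab
      obtain ⟨haX, had⟩ := hA a ha
      by_cases hb : b ∈ X
      · exact Or.inr (Or.inl hb)
      · by_cases hbd : j + 1 < d b
        · left
          exact SimpleGraph.Reachable.trans ha (SimpleGraph.Adj.reachable
            (G := inS G {v | v ∉ X ∧ j + 1 < d v}) ⟨hab, ⟨haX, had⟩, ⟨hb, hbd⟩⟩)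
        · right; right
          refine ⟨hb, ?_, a, hab, ha⟩
          have := hstep hab.symm hb haX
          omega
    · intro a ha haF
      obtain ⟨haX, had⟩ := hA a ha
      by_cases hya : y = a
      · subst hya; omega
      · have := hstep (outer_adj hγ hF haF hy hya) hyX haX
        omega
  choose u c hc hcs hcw using hex
  have hlev : ∀ j, ∀ v ∈ (c j).support, v ∉ X → d v = j + 1 := by
    intro j v hv hvX
    rcases hcs j v hv with h | h
    · exact absurd h hvX
    · exact h.2.1
  refine ⟨u, c, hc, ?_, ?_, ?_⟩
  · intro i j hij v hi hj
    by_contra hvX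
    have h1 := hlev i v hi hvX
    have h2 := hlev j v hj hvX
    apply hij; ext; omega
  · intro i j hij v hv hvX
    obtain ⟨-, hvd, a, hav, hxa⟩ := (hcs j v hv).resolve_left hvX
    have hnot : ∀ b, b ∉ X → j + 1 ≤ d b → b ∉ (c i).support := by
      intro b hbX hbd hb
      have := hlev i b hb hbX
      rw [Fin.lt_def] at hij
      omega
    obtain ⟨w⟩ := hxa
    have hxS : x ∈ {v | v ∉ X ∧ j + 1 < d v} := ⟨hx, lt_of_le_of_lt j.2 hM⟩
    have hsup := inS_support w hxS
    have e1 := wind_reach (γ := γ) hγ.1 (c i) (inS_le _) w (fun b hb => hnot b (hsup b hb).1 (hsup b hb).2.le)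
    have ha := hsup a w.end_mem_support
    have e2 := wind_adj (γ := γ) hγ.1 (c i) hav (hnot a ha.1 ha.2.le) (hnot v hvX hvd.ge)
    rw [← e2, ← e1]
    exact hcw i
  · intro i j hij
    have hnot : ∀ b, b ∉ X → d b ≤ i + 1 → b ∉ (c j).support := by
      intro b hbX hbd hb
      have := hlev j b hb hbX
      rw [Fin.lt_def] at hij
      omega
    have key : ∀ n : ℕ, ∀ v, v ∉ X → d v ≤ n → n ≤ i + 1 → wind γ (γ.vmap v) (c j) = 0 := by
      intro n
      induction n with
      | zero =>
        intro v hvX hvd _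
        have : y = v := by
          have h0 : H.dist y v = 0 := Nat.le_zero.mp hvd
          exact (hreach v hvX).dist_eq_zero_iff.mp h0
        subst this
        exact wind_outer (c j) hF hFR hy (hnot y hyX (by omega))
      | succ n ih =>
        intro v hvX hvd hn
        by_cases hvn : d v ≤ n
        · exact ih v hvX hvn (by omega)
        obtain ⟨w, hw⟩ := (hreach v hvX).symm.exists_walk_length_eq_dist
        rw [SimpleGraph.dist_comm] at hw
        cases w with
        | nil => exact absurd (by omega) hvn
        | @cons _ b _ hvb q =>
          rw [SimpleGraph.Walk.length_cons] at hw
          have hdb : d b ≤ n := by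
            have := SimpleGraph.dist_le q
            rw [SimpleGraph.dist_comm] at this
            have : d b ≤ q.length := this
            have : d v = q.length + 1 := hw.symm
            omega
          rw [wind_adj (γ := γ) hγ.1 (c j) hvb.1 (hnot v hvX (by omega)) (hnot b hvb.2.2 (by omega))]
          exact ih b hvb.2.2 hdb (by omega)
    intro v hv hvX
    exact key _ v hvX (hlev i v hv hvX).le le_rfl

end


section
variable {γ : Drawing G}

lemma mono_fam [Finite V] (X : Finset V) (hX : X.card ≤ 2) {k : ℕ} {u : Fin (16 * k) → V}
    (c : ∀ j, G.Walk (u j) (u j)) :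
    ∃ (f : Fin (2 * k) ↪o Fin (16 * k)) (Y : Finset V) (b : Prop), Y ⊆ X ∧
      (∀ i, ∀ v ∈ X, (v ∈ (c (f i)).support ↔ v ∈ Y)) ∧
      (∀ i, (∃ e ∈ (c (f i)).edges, ∀ v ∈ e, v ∈ X) ↔ b) := by
  classical
  have h := Finset.exists_le_card_fiber_of_mul_le_card_of_maps_to (n := 2 * k)
    (s := (Finset.univ : Finset (Fin (16 * k)))) (t := X.powerset ×ˢ (Finset.univ : Finset Bool))
    (f := fun j => (X.filter (· ∈ (c j).support), decide (∃ e ∈ (c j).edges, ∀ v ∈ e, v ∈ X)))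
    (by intro a _; simp only [Finset.mem_product, Finset.mem_powerset, Finset.filter_subset, Finset.mem_univ, and_self]) ⟨(∅, true), by simp⟩ (by
      rw [Finset.card_product, Finset.card_powerset]
      simp only [Finset.card_univ, Fintype.card_bool, Fintype.card_fin]
      have : 2 ^ X.card ≤ 2 ^ 2 := Nat.pow_le_pow_right (by norm_num) hX
      nlinarith)
  obtain ⟨⟨Y, b⟩, hY, hcard⟩ := h
  have hmem := Finset.orderEmbOfCardLe_mem _ hcard
  generalize Finset.orderEmbOfCardLe _ hcard = f at hmem
  refine ⟨f, Y, b = true, ?_, ?_, ?_⟩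
  · simpa using hY
  all_goals
    intro i
    have hm := hmem i
    rw [Finset.mem_filter, Prod.mk.injEq] at hm
    obtain ⟨-, h1, h2⟩ := hm
  · intro v hv
    rw [← h1, Finset.mem_filter]
    exact ⟨fun h => ⟨hv, h⟩, fun h => h.2⟩
  · rw [← h2, decide_eq_true_iff]

variable [Finite V]

lemma nest_lemma (hγ : γ.IsPlaneTriangulation) (k : ℕ) (X : Finset V) (hX : X.card ≤ 2) {F : Set Plane}
    (hF : ∃ p, p ∉ γ.totalImage ∧ F = faceAt γ p)
    {R : ℝ} (hFR : ∀ z : Plane, R < ‖z‖ → z ∈ F) {y : V} (hy : γ.vmap y ∈ frontier F)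
    (hyX : y ∉ X) {x : V} (hx : x ∉ X) (hM : 16 * k < (inS G (X : Set V)ᶜ).dist y x) :
    ∃ s ∈ ({0, 1, 2} : Set ℕ), ∃ C : Fin k → G.Subgraph, γ.IsSNest s C := by
  classical
  have hcard2 : ∀ Y : Finset V, Y ⊆ X → Y.card ∈ ({0, 1, 2} : Set ℕ) := by
    intro Y hY
    have := (Finset.card_le_card hY).trans hX
    simp only [mem_insert_iff, mem_singleton_iff]
    omega
  obtain ⟨u, c, hc, hdis, hin, hout⟩ := layers hγ X hX hF hFR hy hyX hx hM
  obtain ⟨f, Y, b, hYX, hsup, hb⟩ := mono_fam X hX c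
  by_cases hbb : b
  swap
  · -- no edges inside X
    have hYs : ∀ i v, v ∈ (c (f i)).support → v ∉ Y → v ∉ X := fun i v hv hY hvX =>
      hY ((hsup i v hvX).mp hv)
    let g : Fin k → Fin (2 * k) := fun i => ⟨i, by omega⟩
    have hg : ∀ i j : Fin k, i < j → g i < g j := fun i j h => h
    refine ⟨Y.card, hcard2 Y hYX, _, snest_of_cycles hγ.1 Y (fun i => u (f (g i)))
      (fun i => c (f (g i))) (fun i => hc _) ?_ ?_ ?_ ?_⟩
    · intro i v hv
      exact (hsup _ v (hYX hv)).mpr hv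
    · intro i j hij v hi hj
      have hne : f (g i) ≠ f (g j) := by
        intro h
        have := f.injective h
        apply hij; ext; simpa [g] using this
      exact (hsup _ v (hdis _ _ hne v hi hj)).mp hi
    · intro i j hij v hv hvY
      exact hin _ _ (f.lt_iff_lt.mpr (hg i j hij)) v hv (hYs _ v hv hvY)
    · intro i e he
      by_contra hcon
      push Not at hcon
      exact hbb ((hb (g i)).mp ⟨e, he, fun v hv => hYX (hcon v hv)⟩)
  · -- an edge inside X
    rcases Nat.eq_zero_or_pos k with rfl | hk
    · refine ⟨X.card, hcard2 X (Finset.Subset.refl _), _, snest_of_cycles hγ.1 X (fun i => i.elim0)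
        (fun i => i.elim0) ?_ ?_ ?_ ?_ ?_⟩ <;> exact fun i => i.elim0
    have hab : ∃ a b : V, a ≠ b ∧ X = {a, b} := by
      obtain ⟨e, he, heX⟩ := (hb ⟨0, by omega⟩).mpr hbb
      induction e using Sym2.ind with
      | _ a b =>
        have hadj : G.Adj a b := SimpleGraph.Walk.adj_of_mem_edges _ he
        refine ⟨a, b, hadj.ne, (Finset.eq_of_subset_of_card_le ?_ ?_).symm⟩
        · intro v hv
          simp only [Finset.mem_insert, Finset.mem_singleton] at hv
          rcases hv with rfl | rfl
          · exact heX _ (by simp)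
          · exact heX _ (by simp)
        · rw [Finset.card_pair hadj.ne]; exact hX
    obtain ⟨a, b', hne, hXab⟩ := hab
    have hedge : ∀ e : Sym2 V, e ∈ G.edgeSet → (∀ v ∈ e, v ∈ X) → e = s(a, b') := by
      intro e he heX
      induction e using Sym2.ind with
      | _ p q =>
        have h1 := heX p (by simp)
        have h2 := heX q (by simp)
        have h3 : p ≠ q := (SimpleGraph.mem_edgeSet _ |>.mp he).ne
        rw [hXab] at h1 h2
        simp only [Finset.mem_insert, Finset.mem_singleton] at h1 h2
        rw [Sym2.eq_iff]
        grind
    have hmem : ∀ i, s(a, b') ∈ (c (f i)).edges := by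
      intro i
      obtain ⟨e, he, heX⟩ := (hb i).mpr hbb
      rw [← hedge e (SimpleGraph.Walk.edges_subset_edgeSet _ he) heX]
      exact he
    choose P hP hPe hPs ε hε hPw using fun i => cycle_open γ (c (f i)) (hc _) (hmem i)
    let g : Fin k → Fin (2 * k) := fun i => ⟨i, by omega⟩
    let g' : Fin k → Fin (2 * k) := fun i => ⟨2 * k - 1 - i, by omega⟩
    have hgg : ∀ i j : Fin k, g i < g' j := fun i j => by
      rw [Fin.lt_def]; simp only [g, g']; omega
    have hg : ∀ i j : Fin k, i < j → g i < g j := fun i j h => h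
    have hg' : ∀ i j : Fin k, i < j → g' j < g' i := fun i j h => by
      rw [Fin.lt_def] at h ⊢; simp only [g']; omega
    have hPdis : ∀ i j, i ≠ j → ∀ v, v ∈ (P i).support → v ∈ (P j).support → v ∈ X := by
      intro i j hij v hi hj
      exact hdis _ _ (fun h => hij (f.injective h)) v ((hPs _ v).mp hi) ((hPs _ v).mp hj)
    have hQs : ∀ i v, v ∈ ((P (g i)).append (P (g' i)).reverse).support ↔
        v ∈ (P (g i)).support ∨ v ∈ (P (g' i)).support := by
      intro i v
      rw [SimpleGraph.Walk.mem_support_append_iff, SimpleGraph.Walk.support_reverse, List.mem_reverse]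
    refine ⟨X.card, hcard2 X (Finset.Subset.refl _), _, snest_of_cycles hγ.1 X (fun _ => b')
      (fun i => (P (g i)).append (P (g' i)).reverse) ?_ ?_ ?_ ?_ ?_⟩
    · intro i
      refine (hP _).isCycle_append (hP _).reverse ?_ ?_
      · have n1 := (hP (g i)).support_nodup
        have n2 := (hP (g' i)).reverse.support_nodup
        rw [SimpleGraph.Walk.support_eq_cons, List.nodup_cons] at n1 n2
        intro v h1 h2
        have hvX := hPdis _ _ (hgg i i).ne v (List.mem_of_mem_tail h1)
          (by simpa using List.mem_of_mem_tail h2)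
        rw [hXab] at hvX
        simp only [Finset.mem_insert, Finset.mem_singleton] at hvX
        rcases hvX with rfl | rfl
        · exact n2.1 h2
        · exact n1.1 h1
      · left
        by_contra hlen
        have hPe' := hPe (g i)
        revert hlen hPe'
        generalize P (g i) = Q
        intro hlen hPe'
        cases Q with
        | nil => exact hne rfl
        | cons h q =>
          rw [SimpleGraph.Walk.length_cons] at hlen
          have h0 : q.length = 0 := by omega
          have := SimpleGraph.Walk.eq_of_length_eq_zero h0
          subst this
          apply hPe'
          rw [SimpleGraph.Walk.edges_cons, Sym2.eq_swap]
          exact List.mem_cons_self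
    · intro i v hv
      rw [hQs]
      rw [hXab] at hv
      simp only [Finset.mem_insert, Finset.mem_singleton] at hv
      rcases hv with rfl | rfl
      · exact Or.inl (SimpleGraph.Walk.end_mem_support _)
      · exact Or.inl (SimpleGraph.Walk.start_mem_support _)
    · intro i j hij v hi hj
      rw [hQs] at hi hj
      have n1 : g i ≠ g j := by
        rcases lt_or_gt_of_ne hij with h | h
        · exact (hg _ _ h).ne
        · exact (hg _ _ h).ne'
      have n2 : g' i ≠ g' j := by
        rcases lt_or_gt_of_ne hij with h | h
        · exact (hg' _ _ h).ne'
        · exact (hg' _ _ h).ne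
      rcases hi with hi | hi <;> rcases hj with hj | hj
      · exact hPdis _ _ n1 v hi hj
      · exact hPdis _ _ (hgg _ _).ne v hi hj
      · exact hPdis _ _ (hgg _ _).ne' v hi hj
      · exact hPdis _ _ n2 v hi hj
    · intro i j hij v hv hvX
      rw [hQs] at hv
      obtain ⟨l, hl1, hl2, hvl⟩ : ∃ l, g i < l ∧ l < g' i ∧ v ∈ (c (f l)).support := by
        rcases hv with hv | hv
        · exact ⟨g j, hg _ _ hij, hgg _ _, (hPs _ v).mp hv⟩
        · exact ⟨g' j, hgg _ _, hg' _ _ hij, (hPs _ v).mp hv⟩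
      have w1 := hin _ _ (f.lt_iff_lt.mpr hl1) v hvl hvX
      have w2 := hout _ _ (f.lt_iff_lt.mpr hl2) v hvl hvX
      have e1 := hPw (g i) (γ.vmap v)
      have e2 := hPw (g' i) (γ.vmap v)
      rw [w2, mul_zero] at e2
      rw [wind_append, wind_reverse]
      have e3 : wind γ (γ.vmap v) (P (g i)) + -wind γ (γ.vmap v) (P (g' i))
          = ε (g i) * wind γ (γ.vmap v) (c (f (g i))) := by
        linear_combination e1 - e2
      rw [e3]
      refine mul_ne_zero ?_ w1
      rcases hε (g i) with h | h <;> rw [h] <;> norm_num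
    · intro i e he
      by_contra hcon
      push Not at hcon
      have := hedge e (SimpleGraph.Walk.edges_subset_edgeSet _ he) hcon
      subst this
      rw [SimpleGraph.Walk.edges_append, List.mem_append, SimpleGraph.Walk.edges_reverse,
        List.mem_reverse] at he
      exact he.elim (hPe _) (hPe _)

end


section
variable {γ : Drawing G} [Finite V]

/-- A planar drawing has no `K_{3,3}`-minor. -/
lemma no_k33_graph (h0 : γ.crossings = ∅) {t b : Fin 3 → V} {B : Fin 3 → Set V}
    (ht : Function.Injective t) (hb : ∀ i, b i ∈ B i) (hBt : ∀ i j, t j ∉ B i)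
    (hdis : ∀ i j, i ≠ j → Disjoint (B i) (B j))
    (hcon : ∀ i, ∀ z ∈ B i, (inS G (B i)).Reachable (b i) z)
    (hadj : ∀ i j, ∃ z ∈ B i, G.Adj z (t j)) : False := by
  let E : Fin 3 → Set (Sym2 V) := fun i =>
    {e | e ∈ G.edgeSet ∧ (∃ v ∈ e, v ∈ B i) ∧ ∀ v ∈ e, v ∈ B i ∨ v ∈ range t}
  have hE : ∀ i, E i ⊆ G.edgeSet := fun i e he => he.1
  refine no_k33 (t := fun j => γ.vmap (t j)) (b := fun i => γ.vmap (b i))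
    (Y := fun i => imSE γ (B i) (E i)) (γ.vmap_inj.comp ht) ?_ ?_ ?_ ?_ ?_
  · intro i
    exact (vmap_mem_imSE γ (hE i)).mpr (hb i)
  · intro i j h
    exact hBt i j ((vmap_mem_imSE γ (hE i)).mp h)
  · intro i j hij
    rw [Set.disjoint_left]
    rintro p (⟨v, hv, rfl⟩ | hp) (hq | hq)
    · obtain ⟨v', hv', h⟩ := hq
      rw [γ.vmap_inj h] at hv'
      exact Set.disjoint_left.mp (hdis i j hij) hv hv'
    · simp only [mem_iUnion] at hq
      obtain ⟨e, he, hp⟩ := hq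
      exact γ.avoid e he.1 v hp
    · obtain ⟨v', hv', rfl⟩ := hq
      simp only [mem_iUnion] at hp
      obtain ⟨e, he, hp⟩ := hp
      exact γ.avoid e he.1 v' hp
    · simp only [mem_iUnion] at hp hq
      obtain ⟨e, he, hp⟩ := hp
      obtain ⟨e', he', hq⟩ := hq
      have := emap_inj_of_planar h0 he.1 he'.1 hp hq
      subst this
      obtain ⟨v, hve, hv⟩ := he.2.1
      rcases he'.2.2 v hve with h | ⟨l, rfl⟩
      · exact Set.disjoint_left.mp (hdis i j hij) hv h
      · exact hBt i l hv
  · intro i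
    have : imSE γ (B i) (E i) ∪ range (fun j => γ.vmap (t j)) = imSE γ (B i ∪ range t) (E i) := by
      unfold imSE
      rw [image_union, ← range_comp]
      ext p
      simp only [mem_union, Function.comp_def]
      tauto
    rw [this]
    exact imSE_compact γ (hE i) (fun e he v hv => he.2.2 v hv)
  · intro i j
    have hcarc : ∀ e ∈ E i, carc γ e ⊆ imSE γ (B i) (E i) ∪ γ.vmap '' {v | v ∈ e ∧ v ∉ B i} := by
      rintro e he p (hp | ⟨v, hv, rfl⟩)
      · left; right
        simp only [mem_iUnion]
        exact ⟨e, he, hp⟩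
      · by_cases hvB : v ∈ B i
        · exact Or.inl (Or.inl ⟨v, hvB, rfl⟩)
        · exact Or.inr ⟨v, ⟨hv, hvB⟩, rfl⟩
    obtain ⟨z, hz, hzt⟩ := hadj i j
    have h1 : JoinedIn (imSE γ (B i) (E i) ∪ {γ.vmap (t j)}) (γ.vmap (b i)) (γ.vmap z) := by
      obtain ⟨w⟩ := hcon i z hz
      have hbi := hb i
      generalize b i = x at w hbi
      induction w with
      | nil => exact JoinedIn.refl (Or.inl (Or.inl ⟨_, hbi, rfl⟩))
      | @cons a c d h q ih =>
        refine JoinedIn.trans ((carc_joined γ h.1).mono ?_) (ih hz hzt h.2.2)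
        refine (hcarc s(a, c) ⟨h.1, ⟨a, by simp, h.2.1⟩, ?_⟩).trans ?_
        · intro v hv
          rcases Sym2.mem_iff.mp hv with rfl | rfl
          · exact Or.inl h.2.1
          · exact Or.inl h.2.2
        · rintro p (hp | ⟨v, ⟨hv, hvB⟩, rfl⟩)
          · exact Or.inl hp
          · rcases Sym2.mem_iff.mp hv with rfl | rfl
            · exact absurd h.2.1 hvB
            · exact absurd h.2.2 hvB
    refine h1.trans ((carc_joined γ hzt).mono ?_)
    refine (hcarc s(z, t j) ⟨hzt, ⟨z, by simp, hz⟩, ?_⟩).trans ?_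
    · intro v hv
      rcases Sym2.mem_iff.mp hv with rfl | rfl
      · exact Or.inl hz
      · exact Or.inr ⟨j, rfl⟩
    · rintro p (hp | ⟨v, ⟨hv, hvB⟩, rfl⟩)
      · exact Or.inl hp
      · rcases Sym2.mem_iff.mp hv with rfl | rfl
        · exact absurd hz hvB
        · exact Or.inr rfl

end

section

/-- Size bound for the star lemma. -/
def starN (m : ℕ) : ℕ → ℕ
  | 0 => 1
  | D + 1 => m * starN m D + 1

lemma star_aux (H : SimpleGraph V) (p : V → V) (d : V → ℕ) (m : ℕ)
    (hd : ∀ v, d v ≠ 0 → d (p v) + 1 = d v) (hadj : ∀ v, d v ≠ 0 → H.Adj v (p v)) (D : ℕ) :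
    ∀ (w : V) (U : Finset V), (∀ x ∈ U, d w ≤ d x ∧ d x ≤ d w + D ∧ p^[d x - d w] x = w) →
      starN m D < U.card →
      ∃ w : V, ∃ U' ⊆ U, m ≤ U'.card ∧ ∃ B : V → Finset V,
        (∀ x ∈ U', x ∈ B x ∧ w ∉ B x ∧ (B x).card ≤ D ∧ (∃ z ∈ B x, H.Adj z w) ∧
          ∀ z ∈ B x, (inS H (B x : Set V)).Reachable x z) ∧
        (∀ x ∈ U', ∀ x' ∈ U', x ≠ x' → Disjoint (B x) (B x')) := by
  classical
  have hit : ∀ i v, i ≤ d v → d (p^[i] v) = d v - i := by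
    intro i
    induction i with
    | zero => intro v _; simp
    | succ i ih =>
      intro v hv
      rw [Function.iterate_succ_apply']
      have h1 := ih v (by omega)
      have h2 := hd (p^[i] v) (by omega)
      omega
  induction D with
  | zero =>
    intro w U hU hc
    exfalso
    have : U ⊆ {w} := by
      intro x hx
      obtain ⟨h1, h2, h3⟩ := hU x hx
      have : d x - d w = 0 := by omega
      rw [this] at h3
      simpa using h3
    have := Finset.card_le_card this
    simp [starN] at hc this
    omega
  | succ D ih =>
    intro w U hU hc
    set W := U.erase w with hW
    have hWc : m * starN m D < W.card := by
      have := Finset.pred_card_le_card_erase (s := U) (a := w)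
      rw [← hW] at this
      simp only [starN] at hc
      omega
    have hWd : ∀ x ∈ W, d w < d x := by
      intro x hx
      rw [hW, Finset.mem_erase] at hx
      obtain ⟨h1, h2, h3⟩ := hU x hx.2
      rcases h1.lt_or_eq with h | h
      · exact h
      · rw [h, Nat.sub_self] at h3
        exact absurd h3 hx.1
    have hWU : W ⊆ U := Finset.erase_subset _ _
    let c : V → V := fun x => p^[d x - d w - 1] x
    by_cases hm : m ≤ (W.image c).card
    · have hsec : ∀ y ∈ W.image c, ∃ x ∈ W, c x = y := by
        intro y hy; simpa using hy
      choose! r hrW hrc using hsec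
      refine ⟨w, (W.image c).image r, ?_, ?_, fun x => (Finset.range (d x - d w)).image (fun i => p^[i] x), ?_, ?_⟩
      · intro x hx
        obtain ⟨y, hy, rfl⟩ := Finset.mem_image.mp hx
        exact hWU (hrW y hy)
      · rw [Finset.card_image_of_injOn]
        · exact hm
        · intro y hy y' hy' h
          rw [← hrc y hy, ← hrc y' hy', h]
      · intro x hx
        have hxW : x ∈ W := by
          obtain ⟨y, hy, rfl⟩ := Finset.mem_image.mp hx
          exact hrW y hy
        have hlt := hWd x hxW
        obtain ⟨h1, h2, h3⟩ := hU x (hWU hxW)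
        refine ⟨?_, ?_, ?_, ?_, ?_⟩
        · exact Finset.mem_image.mpr ⟨0, by simp; omega, rfl⟩
        · intro hw
          obtain ⟨i, hi, h⟩ := Finset.mem_image.mp hw
          rw [Finset.mem_range] at hi
          have := hit i x (by omega)
          rw [h] at this
          omega
        · refine Finset.card_image_le.trans ?_
          rw [Finset.card_range]; omega
        · refine ⟨c x, Finset.mem_image.mpr ⟨d x - d w - 1, by simp; omega, rfl⟩, ?_⟩
          have := hadj (c x) (by
            have := hit (d x - d w - 1) x (by omega)
            simp only [c]; omega)
          have e : p (c x) = w := by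
            simp only [c]
            rw [← Function.iterate_succ_apply' p]
            conv_rhs => rw [← h3]
            congr 1; omega
          rwa [e] at this
        · intro z hz
          obtain ⟨i, hi, rfl⟩ := Finset.mem_image.mp hz
          clear hz
          rw [Finset.mem_range] at hi
          induction i with
          | zero => exact SimpleGraph.Reachable.refl _
          | succ i ih2 =>
            refine (ih2 (by omega)).trans (SimpleGraph.Adj.reachable ⟨?_, ?_, ?_⟩)
            · rw [Function.iterate_succ_apply']
              exact hadj _ (by rw [hit i x (by omega)]; omega)
            · exact Finset.mem_coe.mpr (Finset.mem_image.mpr ⟨i, by simp; omega, rfl⟩)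
            · exact Finset.mem_coe.mpr (Finset.mem_image.mpr ⟨i + 1, by simp; omega, rfl⟩)
      · have hkey : ∀ x ∈ W, ∀ i < d x - d w, c (p^[i] x) = c x := by
          intro x hx i hi
          simp only [c]
          rw [hit i x (by omega), ← Function.iterate_add_apply]
          congr 1; omega
        intro x hx x' hx' hne
        obtain ⟨y, hy, rfl⟩ := Finset.mem_image.mp hx
        obtain ⟨y', hy', rfl⟩ := Finset.mem_image.mp hx'
        rw [Finset.disjoint_left]
        intro z hz hz'
        obtain ⟨i, hi, rfl⟩ := Finset.mem_image.mp hz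
        obtain ⟨i', hi', h⟩ := Finset.mem_image.mp hz'
        rw [Finset.mem_range] at hi hi'
        have e1 := hkey _ (hrW y hy) i hi
        have e2 := hkey _ (hrW y' hy') i' hi'
        rw [h, e1, hrc y hy, hrc y' hy'] at e2
        exact hne (by rw [e2])
    · push Not at hm
      obtain ⟨w', hw', hf⟩ := Finset.exists_lt_card_fiber_of_mul_lt_card_of_maps_to (s := W)
        (t := W.image c) (f := c) (n := starN m D) (fun x hx => Finset.mem_image_of_mem c hx) (by
          refine lt_of_le_of_lt ?_ hWc
          exact Nat.mul_le_mul_right _ hm.le)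
      have hdw' : d w' = d w + 1 := by
        obtain ⟨x, hx, rfl⟩ := Finset.mem_image.mp hw'
        have := hWd x hx
        have := hit (d x - d w - 1) x (by omega)
        simp only [c]; omega
      obtain ⟨w₁, U', hU', hm', B, hB, hBd⟩ := ih w' _ (by
        intro x hx
        obtain ⟨hxW, hcx⟩ := Finset.mem_filter.mp hx
        have h0 := hWd x hxW
        obtain ⟨h1, h2, h3⟩ := hU x (hWU hxW)
        refine ⟨by omega, by omega, ?_⟩
        rw [← hcx]
        simp only [c]
        congr 1
        have : d (p^[d x - d w - 1] x) = d w' := congrArg d hcx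
        rw [this]; omega) hf
      refine ⟨w₁, U', hU'.trans ((Finset.filter_subset _ _).trans hWU), hm', B, ?_, hBd⟩
      intro x hx
      obtain ⟨a, b, c, d⟩ := hB x hx
      exact ⟨a, b, c.trans (by omega), d⟩

lemma star_lemma [Finite V] (H : SimpleGraph V) (m D : ℕ) (y : V) (U : Finset V)
    (hU : ∀ x ∈ U, H.Reachable y x ∧ H.dist y x ≤ D) (hc : starN m D < U.card) :
      ∃ w : V, ∃ U' ⊆ U, m ≤ U'.card ∧ ∃ B : V → Finset V,
        (∀ x ∈ U', x ∈ B x ∧ w ∉ B x ∧ (B x).card ≤ D ∧ (∃ z ∈ B x, H.Adj z w) ∧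
          ∀ z ∈ B x, (inS H (B x : Set V)).Reachable x z) ∧
        (∀ x ∈ U', ∀ x' ∈ U', x ≠ x' → Disjoint (B x) (B x')) := by
  classical
  have hp : ∀ v, H.dist y v ≠ 0 → ∃ v', H.Adj v v' ∧ H.dist y v' + 1 = H.dist y v ∧ H.Reachable y v' := by
    intro v hv
    have hr : H.Reachable y v := by
      by_contra h
      exact hv (SimpleGraph.dist_eq_zero_of_not_reachable h)
    obtain ⟨w, hw⟩ := hr.symm.exists_walk_length_eq_dist
    rw [SimpleGraph.dist_comm] at hw
    cases w with
    | nil => simp at hv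
    | @cons _ b _ hvb q =>
      rw [SimpleGraph.Walk.length_cons] at hw
      have h1 := SimpleGraph.dist_le q
      rw [SimpleGraph.dist_comm] at h1
      have hrb : H.Reachable y b := ⟨q.reverse⟩
      have h2 := dist_step hrb hvb.symm
      exact ⟨b, hvb, by omega, hrb⟩
  choose! p hp1 hp2 hp3 using hp
  refine star_aux H p (H.dist y) m hp2 hp1 D y U ?_ hc
  intro x hx
  obtain ⟨hr, hD⟩ := hU x hx
  rw [SimpleGraph.dist_self]
  refine ⟨Nat.zero_le _, by omega, ?_⟩
  rw [Nat.sub_zero]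
  clear hx hD
  generalize hn : H.dist y x = n
  induction n generalizing x with
  | zero => exact (hr.dist_eq_zero_iff.mp hn).symm
  | succ n ih =>
    rw [Function.iterate_succ_apply]
    have h0 : H.dist y x ≠ 0 := by omega
    exact ih (p x) (hp3 x h0) (by have := hp2 x h0; omega)

end


section

lemma conflict_card (A S : Finset V) (B : V → Finset V) [DecidableEq V]
    (hB : ∀ x ∈ A, ∀ x' ∈ A, x ≠ x' → Disjoint (B x) (B x')) :
    (A.filter (fun x => ¬ Disjoint S (B x))).card ≤ S.card := by
  have hex : ∀ x ∈ A.filter (fun x => ¬ Disjoint S (B x)), ∃ z, z ∈ S ∧ z ∈ B x := by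
    intro x hx
    have := (Finset.mem_filter.mp hx).2
    rw [Finset.not_disjoint_iff] at this
    exact this
  choose! g hg1 hg2 using hex
  refine Finset.card_le_card_of_injOn g hg1 ?_
  intro x hx x' hx' h
  by_contra hne
  have := hB x (Finset.mem_filter.mp hx).1 x' (Finset.mem_filter.mp hx').1 hne
  exact Finset.disjoint_left.mp this (hg2 x hx) (h ▸ hg2 x' hx')

lemma pick_three (A : Finset V) (B C : V → Finset V) (D : ℕ)
    (hB : ∀ x ∈ A, ∀ x' ∈ A, x ≠ x' → Disjoint (B x) (B x'))
    (hC : ∀ x ∈ A, ∀ x' ∈ A, x ≠ x' → Disjoint (C x) (C x'))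
    (hBD : ∀ x ∈ A, (B x).card ≤ D) (hCD : ∀ x ∈ A, (C x).card ≤ D) (hA : 4 * D + 2 < A.card) :
    ∃ b : Fin 3 → V, (∀ i, b i ∈ A) ∧ ∀ i j, i ≠ j → b i ≠ b j ∧
      Disjoint (B (b i)) (C (b j)) := by
  classical
  let bad : V → Finset V := fun x => insert x
    (A.filter (fun x' => ¬ Disjoint (B x) (C x')) ∪ A.filter (fun x' => ¬ Disjoint (C x) (B x')))
  have hbad : ∀ x ∈ A, (bad x).card ≤ 2 * D + 1 := by
    intro x hx
    refine (Finset.card_insert_le _ _).trans ?_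
    have h1 := (conflict_card A (B x) C hC).trans (hBD x hx)
    have h2 := (conflict_card A (C x) B hB).trans (hCD x hx)
    have h3 := Finset.card_union_le (A.filter (fun x' => ¬ Disjoint (B x) (C x')))
      (A.filter (fun x' => ¬ Disjoint (C x) (B x')))
    omega
  have hgood : ∀ x, ∀ x' ∈ A, x' ∉ bad x → x ≠ x' ∧ Disjoint (B x) (C x') ∧ Disjoint (B x') (C x) := by
    intro x x' hx' h
    simp only [bad, Finset.mem_insert, Finset.mem_union, Finset.mem_filter, not_or, not_and,
      not_not] at h
    exact ⟨fun e => h.1 e.symm, h.2.1 hx', (h.2.2 hx').symm⟩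
  obtain ⟨x0, hx0⟩ : A.Nonempty := Finset.card_pos.mp (by omega)
  obtain ⟨x1, hx1, h01⟩ : ∃ x ∈ A, x ∉ bad x0 :=
    Finset.exists_mem_notMem_of_card_lt_card (by have := hbad x0 hx0; omega)
  obtain ⟨x2, hx2, h2⟩ : ∃ x ∈ A, x ∉ bad x0 ∪ bad x1 :=
    Finset.exists_mem_notMem_of_card_lt_card (by
      have := hbad x0 hx0
      have := hbad x1 hx1
      have := Finset.card_union_le (bad x0) (bad x1)
      omega)
  rw [Finset.mem_union, not_or] at h2
  obtain ⟨a1, a2, a3⟩ := hgood x0 x1 hx1 h01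
  obtain ⟨b1, b2, b3⟩ := hgood x0 x2 hx2 h2.1
  obtain ⟨c1, c2, c3⟩ := hgood x1 x2 hx2 h2.2
  refine ⟨![x0, x1, x2], ?_, ?_⟩
  · intro i; fin_cases i <;> assumption
  · intro i j hij
    fin_cases i <;> fin_cases j
    · exact absurd rfl hij
    · exact ⟨a1, a2⟩
    · exact ⟨b1, b2⟩
    · exact ⟨a1.symm, a3⟩
    · exact absurd rfl hij
    · exact ⟨c1, c2⟩
    · exact ⟨b1.symm, b3⟩
    · exact ⟨c1.symm, c3⟩
    · exact absurd rfl hij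

/-- Facts about connected sets in `inS G Xᶜ`. -/
lemma inS_avoid {X B : Set V} {x z : V} (hx : x ∉ X)
    (h : (inS (inS G Xᶜ) B).Reachable x z) : z ∉ X := by
  obtain ⟨w⟩ := h.mono (inS_le (G := inS G Xᶜ) B)
  exact inS_support w hx z w.end_mem_support

lemma inS_mono2 {X B B' : Set V} (h : B ⊆ B') : inS (inS G X) B ≤ inS G B' :=
  fun _ _ hab => ⟨hab.1.1, h hab.2.1, h hab.2.2⟩

/-- The number of vertices needed. -/
def bigN (D : ℕ) : ℕ := starN (starN (starN (4 * D + 4) D + 1) D + 1) D + 1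

variable {γ : Drawing G} [Fintype V]

lemma comb_main (h0 : γ.crossings = ∅) (D : ℕ) (hn : bigN D ≤ Fintype.card V)
    (hA : ∀ X : Finset V, X.card ≤ 2 → ∃ y, ∀ x, x ∉ X →
      (inS G (X : Set V)ᶜ).Reachable y x ∧ (inS G (X : Set V)ᶜ).dist y x ≤ D) : False := by
  classical
  -- stage 1
  obtain ⟨y1, hy1⟩ := hA ∅ (by simp)
  obtain ⟨v, U1, -, hm1, B1, hB1, hBd1⟩ := star_lemma _ (starN (starN (4 * D + 4) D + 1) D + 1) D y1
    Finset.univ (fun x _ => hy1 x (by simp)) (by rw [Finset.card_univ]; exact hn)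
  have hex : ∀ x ∈ U1, ∃ z ∈ B1 x, G.Adj z v := by
    intro x hx
    obtain ⟨z, hz, hzv⟩ := (hB1 x hx).2.2.2.1
    exact ⟨z, hz, hzv.1⟩
  choose! r hr1 hr2 using hex
  have hrc : (U1.image r).card = U1.card := by
    apply Finset.card_image_of_injOn
    intro x hx x' hx' h
    by_contra hne
    exact Finset.disjoint_left.mp (hBd1 x hx x' hx' hne) (hr1 x hx) (h ▸ hr1 x' hx')
  have hrv : ∀ x ∈ U1.image r, G.Adj x v := by
    intro x hx
    obtain ⟨x', hx', rfl⟩ := Finset.mem_image.mp hx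
    exact hr2 x' hx'
  -- stage 2
  obtain ⟨y2, hy2⟩ := hA {v} (by simp)
  obtain ⟨u, U2, hU2, hm2, B2, hB2, hBd2⟩ := star_lemma _ (starN (4 * D + 4) D + 1) D y2
    (U1.image r) (fun x hx => hy2 x (by simpa using (hrv x hx).ne)) (by omega)
  have hB2v : ∀ x ∈ U2, v ∉ B2 x := by
    intro x hx hv
    have := inS_avoid (by simpa using (hrv x (hU2 hx)).ne) ((hB2 x hx).2.2.2.2 v hv)
    simp at this
  -- stage 3
  obtain ⟨y3, hy3⟩ := hA {v, u} Finset.card_le_two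
  have hx3 : ∀ x ∈ U2, x ∉ ({v, u} : Finset V) := by
    intro x hx h
    simp only [Finset.mem_insert, Finset.mem_singleton] at h
    rcases h with rfl | rfl
    · exact hB2v x hx (hB2 x hx).1
    · exact (hB2 x hx).2.1 (hB2 x hx).1
  obtain ⟨w, U3, hU3, hm3, B3, hB3, hBd3⟩ := star_lemma _ (4 * D + 4) D y3
    U2 (fun x hx => hy3 x (hx3 x hx)) (by omega)
  have hB3v : ∀ x ∈ U3, ∀ z ∈ B3 x, z ∉ ({v, u} : Finset V) := by
    intro x hx z hz
    exact inS_avoid (X := (({v, u} : Finset V) : Set V)) (hx3 x (hU3 hx)) ((hB3 x hx).2.2.2.2 z hz)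
  -- discard sets containing `w`
  set A := U3.filter (fun x => Disjoint {w} (B2 x)) with hAdef
  have hAU : A ⊆ U3 := Finset.filter_subset _ _
  have hAc : 4 * D + 2 < A.card := by
    have h1 := conflict_card U3 {w} B2 (fun x hx x' hx' => hBd2 x (hU3 hx) x' (hU3 hx'))
    have h2 := Finset.card_filter_add_card_filter_not (s := U3) (fun x => Disjoint {w} (B2 x))
    rw [Finset.card_singleton] at h1
    rw [← hAdef] at h2
    omega
  obtain ⟨b, hbA, hb⟩ := pick_three A B2 B3 D
    (fun x hx x' hx' => hBd2 x (hU3 (hAU hx)) x' (hU3 (hAU hx')))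
    (fun x hx x' hx' => hBd3 x (hAU hx) x' (hAU hx'))
    (fun x hx => (hB2 x (hU3 (hAU hx))).2.2.1) (fun x hx => (hB3 x (hAU hx)).2.2.1) hAc
  have hb3 : ∀ i, b i ∈ U3 := fun i => hAU (hbA i)
  have hb2 : ∀ i, b i ∈ U2 := fun i => hU3 (hb3 i)
  have hw2 : ∀ i, w ∉ B2 (b i) := fun i => by
    have := (Finset.mem_filter.mp (hbA i)).2
    simpa using this
  -- distinctness of u, v, w
  have huv : u ≠ v := by
    obtain ⟨z, -, hz⟩ := (hB2 _ (hb2 0)).2.2.2.1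
    simpa using hz.2.2
  have hwuv : w ≠ v ∧ w ≠ u := by
    obtain ⟨z, -, hz⟩ := (hB3 _ (hb3 0)).2.2.2.1
    simpa using hz.2.2
  refine no_k33_graph (γ := γ) h0 (t := ![v, u, w]) (b := b)
    (B := fun i => ((B2 (b i) ∪ B3 (b i) : Finset V) : Set V)) ?_ ?_ ?_ ?_ ?_ ?_
  · intro i j h
    have h1 := huv.symm
    have h2 := hwuv.1.symm
    have h3 := hwuv.2.symm
    fin_cases i <;> fin_cases j <;> simp_all
  · intro i
    simp [(hB2 _ (hb2 i)).1]
  · intro i j h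
    simp only [Finset.coe_union, mem_union, Finset.mem_coe] at h
    have k3 := fun z => hB3v _ (hb3 i) z
    simp only [Finset.mem_insert, Finset.mem_singleton, not_or] at k3
    fin_cases j
    · rcases h with h | h
      · exact hB2v _ (hb2 i) h
      · exact (k3 _ h).1 rfl
    · rcases h with h | h
      · exact (hB2 _ (hb2 i)).2.1 h
      · exact (k3 _ h).2 rfl
    · rcases h with h | h
      · exact hw2 i h
      · exact (hB3 _ (hb3 i)).2.1 h
  · intro i j hij
    rw [Finset.disjoint_coe]
    obtain ⟨hne, hd⟩ := hb i j hij
    obtain ⟨-, hd'⟩ := hb j i hij.symm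
    simp only [Finset.disjoint_union_left, Finset.disjoint_union_right]
    exact ⟨⟨hBd2 _ (hb2 i) _ (hb2 j) hne, hd'.symm⟩, hd, hBd3 _ (hb3 i) _ (hb3 j) hne⟩
  · intro i z hz
    simp only [Finset.coe_union, mem_union, Finset.mem_coe] at hz
    rcases hz with hz | hz
    · exact ((hB2 _ (hb2 i)).2.2.2.2 z hz).mono (inS_mono2 (by simp))
    · exact ((hB3 _ (hb3 i)).2.2.2.2 z hz).mono (inS_mono2 (by simp))
  · intro i j
    fin_cases j
    · exact ⟨b i, by simp [(hB2 _ (hb2 i)).1], hrv _ (hU2 (hb2 i))⟩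
    · obtain ⟨z, hz, hzu⟩ := (hB2 _ (hb2 i)).2.2.2.1
      exact ⟨z, by simp [hz], hzu.1⟩
    · obtain ⟨z, hz, hzw⟩ := (hB3 _ (hb3 i)).2.2.2.1
      exact ⟨z, by simp [hz], hzw.1⟩

lemma main_thm (hγ : γ.IsPlaneTriangulation) (k : ℕ) (hn : bigN (16 * k) ≤ Fintype.card V) :
    ∃ s ∈ ({0, 1, 2} : Set ℕ), ∃ C : Fin k → G.Subgraph, γ.IsSNest s C := by
  classical
  by_contra hno
  obtain ⟨F, R, hF, hFR⟩ := exists_outer γ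
  refine comb_main hγ.1 (16 * k) hn ?_
  intro X hX
  obtain ⟨p, hp, hFp⟩ := hF
  obtain ⟨T, -, hT3, hTF⟩ := hγ.2 F ⟨p, hp, hFp⟩
  obtain ⟨y, hyT, hyX⟩ : ∃ y ∈ T.verts, y ∉ (X : Set V) := by
    by_contra hcon
    push Not at hcon
    have := Set.ncard_le_ncard (show T.verts ⊆ (X : Set V) from hcon) X.finite_toSet
    rw [hT3, ncard_coe_finset] at this
    omega
  have hy : γ.vmap y ∈ frontier F := by
    rw [hTF]; exact Or.inl ⟨y, hyT, rfl⟩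
  have hyX' : y ∉ X := hyX
  refine ⟨y, fun x hx => ⟨reach_lemma hγ X hX ⟨p, hp, hFp⟩ hFR hy hyX' hx, ?_⟩⟩
  by_contra hd
  push Not at hd
  exact hno (nest_lemma hγ k X hX ⟨p, hp, hFp⟩ hFR hy hyX' hx hd)

end

/-- **Theorem 2 of the paper.** For every integer `k` there exists an
integer `n` such that every plane triangulation on at least `n` vertices has an
`s`-nest of size at least `k` for some `s ∈ {0,1,2}`. -/
theorem statement1 (k : ℕ) :
    ∃ n : ℕ, ∀ (V : Type) [Fintype V] (G : SimpleGraph V) (γ : Drawing G),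
      γ.IsPlaneTriangulation → n ≤ Fintype.card V →
      ∃ s ∈ ({0, 1, 2} : Set ℕ), ∃ t : ℕ, k ≤ t ∧
        ∃ C : Fin t → G.Subgraph, γ.IsSNest s C := by
  refine ⟨bigN (16 * k), fun V _ G γ hγ hn => ?_⟩
  obtain ⟨s, hs, C, hC⟩ := main_thm hγ k hn
  exact ⟨s, hs, k, le_rfl, C, hC⟩

end CrossingPaper
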